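/- There exist an absolute constant c > 0, an infinite set N ⊆ ℕ, and for each n ∈ N a finite connected graph G_n with exactly n vertices and maximum degree at most 10, together with a conductance function c_n : E(G_n) → {1, 2}, such that the mixing times of the lazy simple random walk on G_n (unit conductances) and of the lazy random walk on the network (G_n, c_n) satisfy t_mix(G_n, unit) ≥ (c · log n / log log n) · t_mix(G_n, c_n). In particular, the family {G_n} is not robust: multiplying edge conductances by factors of at most 2 changes the mixing time by an unbounded factor as n → ∞. -/

import Mathlib

open Finset
open scoped Classical

variable {V : Type*} [Fintype V]

/-- Transition matrix of the lazy random walk on the network `(G, c)`: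
stay put with probability `1/2`, otherwise move to a neighbour `u` with
probability proportional to the conductance `c v u`. -/
noncomputable def lazyKernel (G : SimpleGraph V) (c : V → V → ℝ) : Matrix V V ℝ :=
  fun v u =>
    (if v = u then (1 : ℝ) / 2 else 0) +
    (if G.Adj v u then c v u / (2 * ∑ w ∈ Finset.univ.filter (G.Adj v ·), c v w) else 0)

/-- Stationary distribution of the lazy random walk on the network `(G, c)`:
`π(v)` is proportional to the total conductance at `v`. -/
noncomputable def statDist (G : SimpleGraph V) (c : V → V → ℝ) (v : V) : ℝ :=
  (∑ w ∈ Finset.univ.filter (G.Adj v ·), c v w) /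
    (∑ u, ∑ w ∈ Finset.univ.filter (G.Adj u ·), c u w)

/-- Total variation distance between two (signed) measures on a finite set. -/
noncomputable def tvDist (μ ν : V → ℝ) : ℝ := (1 / 2) * ∑ x, |μ x - ν x|

/-- Mixing time of the lazy random walk on `(G, c)` started at `v`. -/
noncomputable def mixingTimeFrom [DecidableEq V] (G : SimpleGraph V) (c : V → V → ℝ)
    (v : V) : ℕ :=
  sInf {t : ℕ | tvDist ((lazyKernel G c ^ t) v) (statDist G c) ≤ 1 / 4}

/-- Mixing time of the lazy random walk on the network `(G, c)`. -/
noncomputable def mixingTime [DecidableEq V] (G : SimpleGraph V) (c : V → V → ℝ) : ℕ :=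
  Finset.univ.sup fun v => mixingTimeFrom G c v

section Abstract

variable {V : Type*} [Fintype V] [DecidableEq V]

/-- Reversible lazy chain `P = (1 + Q) / 2`. -/
structure LazyRev (P Q : Matrix V V ℝ) (π : V → ℝ) : Prop where
  hP : ∀ x y, P x y = ((if x = y then (1 : ℝ) else 0) + Q x y) / 2
  qnn : ∀ x y, 0 ≤ Q x y
  qsum : ∀ x, ∑ y, Q x y = 1
  ppos : ∀ x, 0 < π x
  psum : ∑ x, π x = 1
  rev : ∀ x y, π x * Q x y = π y * Q y x

namespace LazyRev

variable {P Q : Matrix V V ℝ} {π : V → ℝ}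

lemma pnn (h : LazyRev P Q π) (x y : V) : 0 ≤ P x y := by
  rw [h.hP]
  have := h.qnn x y
  split_ifs <;> linarith

lemma act (h : LazyRev P Q π) (f : V → ℝ) (x : V) :
    ∑ y, P x y * f y = (f x + ∑ y, Q x y * f y) / 2 := by
  have : ∀ y, P x y * f y = (if x = y then f y / 2 else 0) + Q x y * f y / 2 := by
    intro y
    rw [h.hP]
    split_ifs <;> ring
  simp only [this, Finset.sum_add_distrib]
  rw [Finset.sum_ite_eq, ← Finset.sum_div]
  simp
  ring

lemma prow (h : LazyRev P Q π) (x : V) : ∑ y, P x y = 1 := by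
  have := h.act (fun _ => 1) x
  simp [h.qsum] at this
  exact this

lemma prev (h : LazyRev P Q π) (x y : V) : π x * P x y = π y * P y x := by
  rw [h.hP, h.hP]
  have := h.rev x y
  by_cases hxy : x = y
  · subst hxy; rfl
  · rw [if_neg hxy, if_neg (Ne.symm hxy)]
    linarith

lemma pow_nn (h : LazyRev P Q π) (t : ℕ) (x y : V) : 0 ≤ (P ^ t) x y := by
  induction t generalizing x y with
  | zero => simp [Matrix.one_apply]; split_ifs <;> norm_num
  | succ t ih =>
    rw [pow_succ, Matrix.mul_apply]
    exact Finset.sum_nonneg fun z _ => mul_nonneg (ih _ _) (h.pnn _ _)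

lemma pow_row (h : LazyRev P Q π) (t : ℕ) (x : V) : ∑ y, (P ^ t) x y = 1 := by
  induction t generalizing x with
  | zero => simp [Matrix.one_apply]
  | succ t ih =>
    simp only [pow_succ', Matrix.mul_apply]
    rw [Finset.sum_comm]
    simp only [← Finset.mul_sum, ih, mul_one, h.prow]

lemma pow_rev (h : LazyRev P Q π) (t : ℕ) (x y : V) :
    π x * (P ^ t) x y = π y * (P ^ t) y x := by
  induction t generalizing x y with
  | zero =>
    simp only [pow_zero, Matrix.one_apply]
    by_cases hxy : x = y
    · subst hxy; rfl
    · rw [if_neg hxy, if_neg (Ne.symm hxy)]; simp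
  | succ t ih =>
    rw [pow_succ, Matrix.mul_apply, ← pow_succ, pow_succ', Matrix.mul_apply, Finset.mul_sum,
      Finset.mul_sum]
    refine Finset.sum_congr rfl fun z _ => ?_
    rw [← mul_assoc, ih, mul_comm (π z), mul_assoc, h.prev z y]; ring

lemma pow_stat (h : LazyRev P Q π) (t : ℕ) (y : V) : ∑ x, π x * (P ^ t) x y = π y := by
  simp only [h.pow_rev t _ y, ← Finset.mul_sum, h.pow_row, mul_one]

lemma p_stat (h : LazyRev P Q π) (y : V) : ∑ x, π x * P x y = π y := by
  simpa using h.pow_stat 1 y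

lemma q_contr (h : LazyRev P Q π) (g : V → ℝ) :
    ∑ x, π x * (∑ y, Q x y * g y) ^ 2 ≤ ∑ x, π x * g x ^ 2 := by
  have h1 : ∀ x, (∑ y, Q x y * g y) ^ 2 ≤ ∑ y, Q x y * g y ^ 2 := by
    intro x
    set a := ∑ y, Q x y * g y with ha
    have h0 : 0 ≤ ∑ y, Q x y * (g y - a) ^ 2 :=
      Finset.sum_nonneg fun y _ => mul_nonneg (h.qnn _ _) (sq_nonneg _)
    have h2 : ∑ y, Q x y * (g y - a) ^ 2 = ∑ y, Q x y * g y ^ 2 - 2 * a * a + a ^ 2 * 1 := by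
      have e : ∀ y, Q x y * (g y - a) ^ 2 =
          Q x y * g y ^ 2 - 2 * a * (Q x y * g y) + a ^ 2 * Q x y := fun y => by ring
      simp only [e, Finset.sum_add_distrib, Finset.sum_sub_distrib, ← Finset.mul_sum, h.qsum]
      rw [← ha]
    nlinarith
  calc ∑ x, π x * (∑ y, Q x y * g y) ^ 2 ≤ ∑ x, π x * ∑ y, Q x y * g y ^ 2 :=
        Finset.sum_le_sum fun x _ => mul_le_mul_of_nonneg_left (h1 x) (h.ppos x).le
    _ = ∑ y, ∑ x, π y * Q y x * g y ^ 2 := by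
        simp only [Finset.mul_sum]
        rw [Finset.sum_comm]
        refine Finset.sum_congr rfl fun y _ => Finset.sum_congr rfl fun x _ => ?_
        rw [← h.rev x y]; ring
    _ = ∑ x, π x * g x ^ 2 := by
        refine Finset.sum_congr rfl fun y _ => ?_
        rw [← Finset.sum_mul, ← Finset.mul_sum, h.qsum, mul_one]

lemma energy1 (h : LazyRev P Q π) (g : V → ℝ) :
    ∑ x, π x * (g x * ∑ y, P x y * g y) ≤ ∑ x, π x * g x ^ 2 := by
  have hc := h.q_contr g
  simp only [h.act]
  have : ∑ x, π x * (g x * ((g x + ∑ y, Q x y * g y) / 2)) ≤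
      ∑ x, (π x * g x ^ 2 * (3 / 4) + π x * (∑ y, Q x y * g y) ^ 2 * (1 / 4)) := by
    refine Finset.sum_le_sum fun x _ => ?_
    have hp := h.ppos x
    have := mul_nonneg hp.le (sq_nonneg (g x - ∑ y, Q x y * g y))
    nlinarith
  rw [Finset.sum_add_distrib, ← Finset.sum_mul, ← Finset.sum_mul] at this
  linarith

lemma energy2 (h : LazyRev P Q π) (g : V → ℝ) :
    ∑ x, π x * (∑ y, P x y * g y) ^ 2 ≤ ∑ x, π x * (g x * ∑ y, P x y * g y) := by
  have hc := h.q_contr g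
  simp only [h.act]
  have : ∑ x, π x * ((g x + ∑ y, Q x y * g y) / 2) ^ 2 =
      ∑ x, (π x * (g x * ((g x + ∑ y, Q x y * g y) / 2)) - π x * g x ^ 2 * (1 / 4)
        + π x * (∑ y, Q x y * g y) ^ 2 * (1 / 4)) := by
    refine Finset.sum_congr rfl fun x _ => ?_
    ring
  rw [Finset.sum_add_distrib, Finset.sum_sub_distrib, ← Finset.sum_mul, ← Finset.sum_mul] at this
  linarith

lemma ret_eq (h : LazyRev P Q π) (o : V) (s t : ℕ) :
    π o * (P ^ (s + t)) o o = ∑ x, π x * ((P ^ s) x o * (P ^ t) x o) := by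
  rw [pow_add, Matrix.mul_apply, Finset.mul_sum]
  refine Finset.sum_congr rfl fun x _ => ?_
  rw [← mul_assoc, h.pow_rev s o x]; ring

lemma ret_anti_step (h : LazyRev P Q π) (o : V) (t : ℕ) :
    (P ^ (t + 1)) o o ≤ (P ^ t) o o := by
  have hpo := h.ppos o
  have hstep : ∀ s x, ∑ y, P x y * (P ^ s) y o = (P ^ (s + 1)) x o := by
    intro s x; rw [pow_succ', Matrix.mul_apply]
  refine le_of_mul_le_mul_left ?_ hpo
  rcases Nat.even_or_odd' t with ⟨s, rfl | rfl⟩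
  · rw [show 2 * s + 1 = s + (s + 1) by ring, show 2 * s = s + s by ring, h.ret_eq, h.ret_eq]
    have := h.energy1 (fun x => (P ^ s) x o)
    simp only [hstep] at this
    simpa [sq] using this
  · rw [show 2 * s + 1 + 1 = (s + 1) + (s + 1) by ring, show 2 * s + 1 = s + (s + 1) by ring,
      h.ret_eq, h.ret_eq]
    have := h.energy2 (fun x => (P ^ s) x o)
    simp only [hstep] at this
    simpa [sq] using this

lemma ret_anti (h : LazyRev P Q π) (o : V) : Antitone fun t => (P ^ t) o o :=
  antitone_nat_of_succ_le fun t => h.ret_anti_step o t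

/-- Truncated expected hitting time of `o`. -/
noncomputable def hitN (P : Matrix V V ℝ) (o : V) : ℕ → V → ℝ
  | 0 => fun _ => 0
  | k + 1 => fun x => if x = o then 0 else 1 + ∑ y, P x y * hitN P o k y

/-- Probability of not having hit `o` by time `k`. -/
noncomputable def surv (P : Matrix V V ℝ) (o : V) : ℕ → V → ℝ
  | 0 => fun x => if x = o then 0 else 1
  | k + 1 => fun x => if x = o then 0 else ∑ y, P x y * surv P o k y

lemma surv_nn (h : LazyRev P Q π) (o : V) (k : ℕ) (x : V) : 0 ≤ surv P o k x := by
  induction k generalizing x with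
  | zero => simp only [surv]; split_ifs <;> norm_num
  | succ k ih =>
    simp only [surv]; split_ifs
    · exact le_rfl
    · exact Finset.sum_nonneg fun y _ => mul_nonneg (h.pnn _ _) (ih y)

lemma surv_anti (h : LazyRev P Q π) (o : V) (k : ℕ) (x : V) :
    surv P o (k + 1) x ≤ surv P o k x := by
  induction k generalizing x with
  | zero =>
    simp only [surv]; split_ifs
    · exact le_rfl
    · calc _ ≤ ∑ y, P x y * 1 := Finset.sum_le_sum fun y _ =>
            mul_le_mul_of_nonneg_left (by split_ifs <;> norm_num) (h.pnn _ _)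
        _ = 1 := by simp [h.prow]
  | succ k ih =>
    rw [surv]
    conv_rhs => rw [surv]
    beta_reduce
    split_ifs
    · exact le_rfl
    · exact Finset.sum_le_sum fun y _ => mul_le_mul_of_nonneg_left (ih y) (h.pnn _ _)

lemma hitN_eq (h : LazyRev P Q π) (o : V) (k : ℕ) (x : V) :
    hitN P o (k + 1) x = hitN P o k x + surv P o k x := by
  induction k generalizing x with
  | zero => simp only [hitN, surv]; split_ifs <;> simp
  | succ k ih =>
    rw [hitN]
    conv_rhs => rw [hitN, surv]
    beta_reduce
    split_ifs
    · simp
    · simp only [ih, mul_add, Finset.sum_add_distrib]; ring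

lemma hitN_ge (h : LazyRev P Q π) (o : V) (k : ℕ) (x : V) :
    k * surv P o k x ≤ hitN P o k x := by
  induction k with
  | zero => simp [hitN]
  | succ k ih =>
    rw [h.hitN_eq]
    have h1 := h.surv_anti o k x
    have h2 := h.surv_nn o (k + 1) x
    push_cast
    have : (k : ℝ) * surv P o (k + 1) x ≤ k * surv P o k x :=
      mul_le_mul_of_nonneg_left h1 (Nat.cast_nonneg k)
    linarith

lemma hitN_le (h : LazyRev P Q π) (o : V) (F : V → ℝ) (hF : ∀ x, 0 ≤ F x)
    (hd : ∀ x, x ≠ o → ∑ y, P x y * F y ≤ F x - 1) (k : ℕ) (x : V) : hitN P o k x ≤ F x := by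
  induction k generalizing x with
  | zero => exact hF x
  | succ k ih =>
    simp only [hitN]
    split_ifs with hx
    · exact hF x
    · have := hd x hx
      have h2 : ∑ y, P x y * hitN P o k y ≤ ∑ y, P x y * F y :=
        Finset.sum_le_sum fun y _ => mul_le_mul_of_nonneg_left (ih y) (h.pnn _ _)
      linarith

/-- The exact hitting time function. -/
lemma exists_hit (h : LazyRev P Q π) (o : V) (F : V → ℝ) (hF : ∀ x, 0 ≤ F x)
    (hd : ∀ x, x ≠ o → ∑ y, P x y * F y ≤ F x - 1) :
    ∃ g : V → ℝ, g o = 0 ∧ (∀ x, 0 ≤ g x) ∧ (∀ x, g x ≤ F x) ∧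
      ∀ x, x ≠ o → ∑ y, P x y * g y = g x - 1 := by
  have hmono : ∀ x, Monotone fun k => hitN P o k x := fun x =>
    monotone_nat_of_le_succ fun k => by
      rw [h.hitN_eq]; have := h.surv_nn o k x; linarith
  have hb : ∀ x, BddAbove (Set.range fun k => hitN P o k x) := fun x =>
    ⟨F x, by rintro _ ⟨k, rfl⟩; exact h.hitN_le o F hF hd k x⟩
  have ht : ∀ x, Filter.Tendsto (fun k => hitN P o k x) Filter.atTop
      (nhds (⨆ k, hitN P o k x)) := fun x => tendsto_atTop_ciSup (hmono x) (hb x)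
  refine ⟨fun x => ⨆ k, hitN P o k x, ?_, ?_, ?_, ?_⟩
  · refine tendsto_nhds_unique (ht o) ?_
    have : (fun k => hitN P o k o) = fun _ => 0 := by
      funext k; cases k <;> simp [hitN]
    rw [this]; exact tendsto_const_nhds
  · intro x
    exact ge_of_tendsto' (ht x) fun k => by
      have := hmono x (Nat.zero_le k); simpa [hitN] using this
  · intro x
    exact le_of_tendsto' (ht x) fun k => h.hitN_le o F hF hd k x
  · intro x hx
    have h1 := (ht x).comp (Filter.tendsto_add_atTop_nat 1)
    have h2 : Filter.Tendsto (fun k => 1 + ∑ y, P x y * hitN P o k y) Filter.atTop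
        (nhds (1 + ∑ y, P x y * ⨆ k, hitN P o k y)) :=
      tendsto_const_nhds.add (tendsto_finsetSum _ fun y _ => (ht y).const_mul _)
    have h3 := tendsto_nhds_unique h1 (h2.congr fun k => by simp [hitN, hx])
    linarith

lemma ret_bound (h : LazyRev P Q π) (o : V) (F : V → ℝ) (H : ℝ) (hF : ∀ x, 0 ≤ F x)
    (hH : ∀ x, F x ≤ H)
    (hd : ∀ x, x ≠ o → ∑ y, P x y * F y ≤ F x - 1) (T : ℕ) :
    T * ((P ^ T) o o / π o - 1) ≤ H := by
  obtain ⟨g, g0, gnn, gF, gd⟩ := h.exists_hit o F hF hd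
  have hpo := h.ppos o
  -- value at o
  have hgo : ∑ y, P o y * g y = 1 / π o - 1 := by
    have e1 : ∑ x, π x * ∑ y, P x y * g y = ∑ y, π y * g y := by
      simp only [Finset.mul_sum]
      rw [Finset.sum_comm]
      refine Finset.sum_congr rfl fun y _ => ?_
      rw [← h.p_stat y, Finset.sum_mul]
      refine Finset.sum_congr rfl fun x _ => ?_
      ring
    have e2 : ∑ x, π x * ∑ y, P x y * g y =
        ∑ x, (π x * (g x - 1) + if x = o then π o * (∑ y, P o y * g y + 1) else 0) := by
      refine Finset.sum_congr rfl fun x _ => ?_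
      split_ifs with hx
      · subst hx; rw [g0]; ring
      · rw [gd x hx]; ring
    rw [Finset.sum_add_distrib, Finset.sum_ite_eq' Finset.univ o] at e2
    simp only [mul_sub, mul_one, Finset.sum_sub_distrib, h.psum, Finset.mem_univ, if_true] at e2
    rw [e1] at e2
    field_simp
    linarith
  have tel : ∀ t, ∑ y, (P ^ (t + 1)) o y * g y = ∑ y, (P ^ t) o y * g y +
      ((P ^ t) o o / π o - 1) := by
    intro t
    have e1 : ∑ y, (P ^ (t + 1)) o y * g y = ∑ x, (P ^ t) o x * ∑ y, P x y * g y := by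
      simp only [pow_succ, Matrix.mul_apply, Finset.sum_mul, Finset.mul_sum]
      rw [Finset.sum_comm]
      refine Finset.sum_congr rfl fun y _ => Finset.sum_congr rfl fun x _ => by ring
    have e2 : ∑ x, (P ^ t) o x * ∑ y, P x y * g y = ∑ x, ((P ^ t) o x * g x - (P ^ t) o x +
        if x = o then (P ^ t) o o / π o else 0) := by
      refine Finset.sum_congr rfl fun x _ => ?_
      split_ifs with hx
      · subst hx; rw [g0, hgo]; ring
      · rw [gd x hx]; ring
    rw [e1, e2, Finset.sum_add_distrib, Finset.sum_sub_distrib, h.pow_row,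
      Finset.sum_ite_eq' Finset.univ o]
    simp
    ring
  have hsum : ∀ n : ℕ, n ≤ T → n * ((P ^ T) o o / π o - 1) ≤ ∑ y, (P ^ n) o y * g y := by
    intro n
    induction n with
    | zero =>
      intro _
      simp only [Nat.cast_zero, zero_mul]
      exact Finset.sum_nonneg fun y _ => mul_nonneg (h.pow_nn _ _ _) (gnn y)
    | succ n ih =>
      intro hn
      rw [tel]
      have := ih (by omega)
      have h2 : (P ^ T) o o / π o ≤ (P ^ n) o o / π o :=
        div_le_div_of_nonneg_right (h.ret_anti o (by omega)) hpo.le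
      push_cast
      linarith
  refine (hsum T le_rfl).trans ?_
  calc ∑ y, (P ^ T) o y * g y ≤ ∑ y, (P ^ T) o y * H := Finset.sum_le_sum fun y _ =>
        mul_le_mul_of_nonneg_left ((gF y).trans (hH y)) (h.pow_nn _ _ _)
    _ = H := by rw [← Finset.sum_mul, h.pow_row, one_mul]

lemma dist_o (h : LazyRev P Q π) (o : V) (s : ℕ) :
    (∑ y, |(P ^ s) o y - π y|) ^ 2 ≤ (P ^ (s + s)) o o / π o - 1 := by
  have hpo := h.ppos o
  have e1 : ∀ y, |(P ^ s) o y - π y| = π y * |(P ^ s) y o / π o - 1| := by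
    intro y
    have hy := h.ppos y
    rw [← abs_of_pos hy, ← abs_mul, abs_of_pos hy]
    congr 1
    have := h.pow_rev s o y
    field_simp
    linarith
  have e2 : ∑ y, π y * ((P ^ s) y o / π o - 1) ^ 2 = (P ^ (s + s)) o o / π o - 1 := by
    have r := h.ret_eq o s s
    have st := h.pow_stat s o
    have : ∀ y, π y * ((P ^ s) y o / π o - 1) ^ 2 =
        π y * ((P ^ s) y o * (P ^ s) y o) / π o ^ 2 - 2 / π o * (π y * (P ^ s) y o) + π y := by
      intro y; field_simp; ring
    simp only [this, Finset.sum_add_distrib, Finset.sum_sub_distrib, ← Finset.mul_sum,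
      ← Finset.sum_div, st, h.psum, ← r]
    field_simp
    ring
  rw [← e2]
  simp only [e1]
  have := Finset.sum_mul_sq_le_sq_mul_sq Finset.univ (fun y => Real.sqrt (π y))
    (fun y => Real.sqrt (π y) * |(P ^ s) y o / π o - 1|)
  have e3 : ∀ y, Real.sqrt (π y) * (Real.sqrt (π y) * |(P ^ s) y o / π o - 1|) =
      π y * |(P ^ s) y o / π o - 1| := by
    intro y; rw [← mul_assoc, Real.mul_self_sqrt (h.ppos y).le]
  simp only [e3, mul_pow, Real.sq_sqrt (h.ppos _).le, sq_abs, h.psum, one_mul] at this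
  exact this

theorem mix_upper (h : LazyRev P Q π) (o : V) (F : V → ℝ) (H : ℝ) (hF : ∀ x, 0 ≤ F x)
    (hH : ∀ x, F x ≤ H)
    (hd : ∀ x, x ≠ o → ∑ y, P x y * F y ≤ F x - 1) (k : ℕ) (hk : 8 * H ≤ k) (hk1 : 1 ≤ k)
    (x : V) : ∑ y, |(P ^ (k + k)) x y - π y| ≤ 1 / 2 := by
  have hk0 : (0 : ℝ) < k := by exact_mod_cast hk1
  have ho : ∀ s, k ≤ s → ∑ y, |(P ^ s) o y - π y| ≤ 1 / 4 := by
    intro s hs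
    have hs0 : (k : ℝ) ≤ s := by exact_mod_cast hs
    have h1 := h.dist_o o s
    have h2 := h.ret_bound o F H hF hH hd (s + s)
    push_cast at h2
    have h3 : (P ^ (s + s)) o o / π o - 1 ≤ 1 / 16 := by
      by_contra hc
      push Not at hc
      nlinarith
    exact abs_le_of_sq_le_sq' (by linarith) (by norm_num) |>.2
  have hdist2 : ∀ s z, ∑ y, |(P ^ s) z y - π y| ≤ 2 := by
    intro s z
    calc _ ≤ ∑ y, ((P ^ s) z y + π y) := Finset.sum_le_sum fun y _ => by
          have a := h.pow_nn s z y
          have b := (h.ppos y).le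
          rw [abs_le]; constructor <;> linarith
      _ = 2 := by rw [Finset.sum_add_distrib, h.pow_row, h.psum]; norm_num
  have key : ∀ j z, ∑ y, |(P ^ (k + j)) z y - π y| ≤ 1 / 4 + 2 * surv P o j z := by
    intro j
    induction j with
    | zero =>
      intro z
      simp only [surv]
      split_ifs with hz
      · subst hz; simpa using ho _ le_rfl
      · have := hdist2 (k + 0) z
        linarith
    | succ j ih =>
      intro z
      simp only [surv]
      split_ifs with hz
      · subst hz
        have := ho (k + (j + 1)) (by omega)
        linarith
      · have e : ∀ y, (P ^ (k + (j + 1))) z y - π y =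
            ∑ u, P z u * ((P ^ (k + j)) u y - π y) := by
          intro y
          rw [← add_assoc, pow_succ', Matrix.mul_apply]
          simp only [mul_sub, Finset.sum_sub_distrib, ← Finset.sum_mul, h.prow, one_mul]
        calc ∑ y, |(P ^ (k + (j + 1))) z y - π y|
            ≤ ∑ y, ∑ u, P z u * |(P ^ (k + j)) u y - π y| := by
              refine Finset.sum_le_sum fun y _ => ?_
              rw [e]
              refine (Finset.abs_sum_le_sum_abs _ _).trans (le_of_eq ?_)
              refine Finset.sum_congr rfl fun u _ => ?_
              rw [abs_mul, abs_of_nonneg (h.pnn z u)]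
          _ = ∑ u, P z u * ∑ y, |(P ^ (k + j)) u y - π y| := by
              rw [Finset.sum_comm]; simp only [Finset.mul_sum]
          _ ≤ ∑ u, P z u * (1 / 4 + 2 * surv P o j u) := Finset.sum_le_sum fun u _ =>
              mul_le_mul_of_nonneg_left (ih u) (h.pnn z u)
          _ = 1 / 4 + 2 * ∑ u, P z u * surv P o j u := by
              simp only [mul_add, Finset.sum_add_distrib, ← Finset.sum_mul, h.prow, one_mul,
                Finset.mul_sum]
              congr 1
              refine Finset.sum_congr rfl fun u _ => by ring
  have h1 := key k x
  have h2 := h.hitN_ge o k x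
  have h3 := h.hitN_le o F hF hd k x
  have h4 := hH x
  have h5 : surv P o k x ≤ 1 / 8 := by
    by_contra hc
    push Not at hc
    nlinarith
  linarith

/-- Upper bound on the expectation of a test function with bounded drift. -/
lemma drift_pow (h : LazyRev P Q π) (f : V → ℝ) (ε : ℝ)
    (hf : ∀ x, ∑ y, P x y * f y ≤ f x + ε) (t : ℕ) (x : V) :
    ∑ y, (P ^ t) x y * f y ≤ f x + t * ε := by
  induction t generalizing x with
  | zero => simp [Matrix.one_apply]
  | succ t ih =>
    have e1 : ∑ y, (P ^ (t + 1)) x y * f y = ∑ z, (P ^ t) x z * ∑ y, P z y * f y := by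
      simp only [pow_succ, Matrix.mul_apply, Finset.sum_mul, Finset.mul_sum]
      rw [Finset.sum_comm]
      refine Finset.sum_congr rfl fun y _ => Finset.sum_congr rfl fun x _ => by ring
    rw [e1]
    calc _ ≤ ∑ z, (P ^ t) x z * (f z + ε) := Finset.sum_le_sum fun z _ =>
          mul_le_mul_of_nonneg_left (hf z) (h.pow_nn _ _ _)
      _ = ∑ z, (P ^ t) x z * f z + ε := by
          simp only [mul_add, Finset.sum_add_distrib, ← Finset.sum_mul, h.pow_row, one_mul]
      _ ≤ _ := by have := ih x; push_cast; linarith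

end LazyRev

end Abstract
section Network

variable {V : Type*} [Fintype V]

/-- Total conductance at a vertex. -/
noncomputable def cs (G : SimpleGraph V) (c : V → V → ℝ) (v : V) : ℝ :=
  ∑ w ∈ Finset.univ.filter (G.Adj v ·), c v w

/-- Non-lazy kernel. -/
noncomputable def qKernel (G : SimpleGraph V) (c : V → V → ℝ) : Matrix V V ℝ :=
  fun v u => if G.Adj v u then c v u / cs G c v else 0

/-- Admissible conductances. -/
structure Good (G : SimpleGraph V) (c : V → V → ℝ) : Prop where
  symm : ∀ u v, c u v = c v u
  pos : ∀ u v, G.Adj u v → 0 < c u v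
  nbr : ∀ v, ∃ u, G.Adj v u

lemma Good.cs_pos {G : SimpleGraph V} {c : V → V → ℝ} (h : Good G c) (v : V) : 0 < cs G c v := by
  obtain ⟨u, hu⟩ := h.nbr v
  refine Finset.sum_pos (fun w hw => h.pos v w (by simpa using hw)) ⟨u, by simpa using hu⟩

lemma Good.lazyRev [DecidableEq V] [Nonempty V] {G : SimpleGraph V} {c : V → V → ℝ}
    (h : Good G c) : LazyRev (lazyKernel G c) (qKernel G c) (statDist G c) := by
  have hpos := h.cs_pos
  have htot : 0 < ∑ u, cs G c u := Finset.sum_pos (fun u _ => hpos u) Finset.univ_nonempty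
  refine ⟨?_, ?_, ?_, ?_, ?_, ?_⟩
  · intro x y
    have := (hpos x).ne'
    unfold lazyKernel qKernel
    change _ + (if G.Adj x y then c x y / (2 * cs G c x) else 0) = _
    by_cases ha : G.Adj x y
    · rw [if_pos ha, if_pos ha]
      split_ifs <;> field_simp <;> simp
    · rw [if_neg ha, if_neg ha]
      split_ifs <;> norm_num
  · intro x y
    unfold qKernel
    split_ifs with ha
    · exact div_nonneg (h.pos x y ha).le (hpos x).le
    · exact le_rfl
  · intro x
    unfold qKernel
    rw [← Finset.sum_filter, ← Finset.sum_div]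
    exact div_self (hpos x).ne'
  · intro x
    exact div_pos (hpos x) htot
  · have : ∑ x, statDist G c x = (∑ x, cs G c x) / ∑ u, cs G c u := by
      rw [Finset.sum_div]; rfl
    rw [this, div_self htot.ne']
  · intro x y
    unfold qKernel
    change cs G c x / (∑ u, cs G c u) * _ = cs G c y / (∑ u, cs G c u) * _
    have hx := (hpos x).ne'
    have hy := (hpos y).ne'
    have ht := htot.ne'
    by_cases ha : G.Adj x y
    · rw [if_pos ha, if_pos ha.symm, h.symm x y]; field_simp
    · rw [if_neg ha, if_neg (fun h' => ha h'.symm)]; simp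

lemma Good.drift [DecidableEq V] [Nonempty V] {G : SimpleGraph V} {c : V → V → ℝ}
    (h : Good G c) (f : V → ℝ) (η : ℝ) (x : V)
    (hx : ∑ u ∈ Finset.univ.filter (G.Adj x ·), c x u * (f u - f x) ≤ 2 * η * cs G c x) :
    ∑ y, lazyKernel G c x y * f y ≤ f x + η := by
  rw [h.lazyRev.act]
  have hp := h.cs_pos x
  have e : ∑ y, qKernel G c x y * f y = f x +
      (∑ u ∈ Finset.univ.filter (G.Adj x ·), c x u * (f u - f x)) / cs G c x := by
    simp only [mul_sub, Finset.sum_sub_distrib, ← Finset.sum_mul]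
    change _ = f x + (_ - cs G c x * f x) / cs G c x
    rw [sub_div, mul_div_cancel_left₀ _ hp.ne', Finset.sum_div, Finset.sum_filter]
    simp only [qKernel]
    rw [add_sub_cancel]
    refine Finset.sum_congr rfl fun y _ => ?_
    split_ifs
    · ring
    · simp
  rw [e]
  have : (∑ u ∈ Finset.univ.filter (G.Adj x ·), c x u * (f u - f x)) / cs G c x ≤ 2 * η := by
    rw [div_le_iff₀ hp]; exact hx
  linarith

theorem Good.upper [DecidableEq V] [Nonempty V] {G : SimpleGraph V} {c : V → V → ℝ}
    (h : Good G c) (o : V) (F : V → ℝ) (H : ℝ) (hF : ∀ x, 0 ≤ F x)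
    (hH : ∀ x, F x ≤ H)
    (hd : ∀ x, x ≠ o → ∑ u ∈ Finset.univ.filter (G.Adj x ·), c x u * (F u - F x) ≤
      - 2 * cs G c x) (k : ℕ) (hk : 8 * H ≤ k) (hk1 : 1 ≤ k) (x : V) :
    tvDist ((lazyKernel G c ^ (k + k)) x) (statDist G c) ≤ 1 / 4 := by
  have := h.lazyRev.mix_upper o F H hF hH (fun x hx => by
    have := h.drift F (-1) x (by have := hd x hx; linarith)
    linarith) k hk hk1 x
  unfold tvDist
  linarith

theorem Good.mixing_le [DecidableEq V] [Nonempty V] {G : SimpleGraph V} {c : V → V → ℝ}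
    (h : Good G c) (o : V) (F : V → ℝ) (H : ℝ) (hF : ∀ x, 0 ≤ F x)
    (hH : ∀ x, F x ≤ H)
    (hd : ∀ x, x ≠ o → ∑ u ∈ Finset.univ.filter (G.Adj x ·), c x u * (F u - F x) ≤
      - 2 * cs G c x) (k : ℕ) (hk : 8 * H ≤ k) (hk1 : 1 ≤ k) :
    mixingTime G c ≤ k + k := by
  refine Finset.sup_le fun x _ => Nat.sInf_le ?_
  exact h.upper o F H hF hH hd k hk hk1 x

lemma rank_reach (G : SimpleGraph V) (o : V) (rk : V → ℕ)
    (hr : ∀ x, x ≠ o → ∃ y, G.Adj x y ∧ rk y < rk x) (x : V) : G.Reachable x o := by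
  induction hn : rk x using Nat.strong_induction_on generalizing x with
  | _ n ih =>
    by_cases hx : x = o
    · subst hx; exact SimpleGraph.Reachable.refl _
    · obtain ⟨y, hy, hlt⟩ := hr x hx
      exact hy.reachable.trans (ih (rk y) (by omega) y rfl)

lemma rank_connected (G : SimpleGraph V) (o : V) (rk : V → ℕ)
    (hr : ∀ x, x ≠ o → ∃ y, G.Adj x y ∧ rk y < rk x) : G.Connected := by
  have : Nonempty V := ⟨o⟩
  exact ⟨fun x y => (rank_reach G o rk hr x).trans (rank_reach G o rk hr y).symm⟩

theorem unit_finite [DecidableEq V] [Nonempty V] {G : SimpleGraph V}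
    (h : Good G (fun _ _ => 1)) (o : V) (rk : V → ℕ)
    (hr : ∀ x, x ≠ o → ∃ y, G.Adj x y ∧ rk y < rk x) (x : V) :
    ∃ t, tvDist ((lazyKernel G (fun _ _ => 1) ^ t) x) (statDist G (fun _ _ => 1)) ≤ 1 / 4 := by
  set N := Finset.univ.sup rk with hN
  have hrk : ∀ x, rk x ≤ N := fun x => Finset.le_sup (Finset.mem_univ x)
  set n : ℝ := (Fintype.card V : ℝ) with hn
  have hn1 : 1 ≤ n := by
    have : 1 ≤ Fintype.card V := Fintype.card_pos
    rw [hn]; exact_mod_cast this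
  set R : ℝ := 3 * n with hR
  have hR1 : 1 ≤ R := by linarith
  set F : V → ℝ := fun x => R ^ N - R ^ (N - rk x) with hF
  obtain ⟨k, hk⟩ := exists_nat_ge (max 1 (8 * R ^ N))
  refine ⟨k + k, h.upper o F (R ^ N) ?_ ?_ ?_ k ((le_max_right _ _).trans hk)
    (by exact_mod_cast (le_max_left _ _).trans hk) x⟩
  · intro x
    have : R ^ (N - rk x) ≤ R ^ N := pow_le_pow_right₀ hR1 (Nat.sub_le _ _)
    simp only [hF]; linarith
  · intro x
    have : 0 < R ^ (N - rk x) := by positivity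
    simp only [hF]; linarith
  · intro x hx
    obtain ⟨y, hy, hlt⟩ := hr x hx
    set q := R ^ (N - rk x) with hq
    have hq1 : 1 ≤ q := one_le_pow₀ hR1
    have hyq : R * q ≤ R ^ (N - rk y) := by
      rw [hq, ← pow_succ']
      exact pow_le_pow_right₀ hR1 (by have := hrk x; omega)
    have hcs : cs G (fun _ _ => (1 : ℝ)) x ≤ n := by
      unfold cs
      rw [Finset.sum_const, nsmul_eq_mul, mul_one, hn]
      exact_mod_cast Finset.card_le_univ _
    have hcs0 := (h.cs_pos x).le
    have hle : ∑ u ∈ Finset.univ.filter (G.Adj x ·), 1 * (F u - F x) ≤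
        ∑ u ∈ Finset.univ.filter (G.Adj x ·), (1 * q + if u = y then - (R * q) else 0) := by
      refine Finset.sum_le_sum fun u _ => ?_
      simp only [hF]
      split_ifs with hu
      · subst hu; linarith
      · have : 0 < R ^ (N - rk u) := by positivity
        linarith
    rw [Finset.sum_add_distrib, Finset.sum_ite_eq', if_pos (by simpa using hy),
      ← Finset.sum_mul] at hle
    refine hle.trans ?_
    change cs G (fun _ _ => (1 : ℝ)) x * q + _ ≤ _
    nlinarith

theorem unit_lower [DecidableEq V] [Nonempty V] {G : SimpleGraph V} {c : V → V → ℝ}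
    (h : Good G c) (v : V) (hfin : ∃ t, tvDist ((lazyKernel G c ^ t) v) (statDist G c) ≤ 1 / 4)
    (f : V → ℝ) (B : V → Prop) (ε : ℝ) (T : ℕ) (hε : 0 ≤ ε) (hf0 : ∀ x, 0 ≤ f x)
    (hfB : ∀ x, B x → 1 ≤ f x)
    (hd : ∀ x, ∑ u ∈ Finset.univ.filter (G.Adj x ·), c x u * (f u - f x) ≤ 2 * ε * cs G c x)
    (hB : 3 / 4 ≤ ∑ x ∈ Finset.univ.filter B, statDist G c x)
    (hT : f v + T * ε ≤ 9 / 20) : T ≤ mixingTime G c := by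
  refine le_trans ?_ (Finset.le_sup (f := fun v => mixingTimeFrom G c v) (Finset.mem_univ v))
  refine le_csInf hfin fun t ht => ?_
  by_contra hlt
  push Not at hlt
  have hlr := h.lazyRev
  have h1 := hlr.drift_pow f ε (fun x => h.drift f ε x (hd x)) t v
  have h2 : ∑ x ∈ Finset.univ.filter B, (lazyKernel G c ^ t) v x ≤
      ∑ y, (lazyKernel G c ^ t) v y * f y := by
    rw [Finset.sum_filter]
    refine Finset.sum_le_sum fun y _ => ?_
    have := hlr.pow_nn t v y
    split_ifs with hy
    · exact le_mul_of_one_le_right this (hfB y hy)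
    · exact mul_nonneg this (hf0 y)
  have h3 : (t : ℝ) * ε ≤ T * ε := mul_le_mul_of_nonneg_right (by exact_mod_cast hlt.le) hε
  simp only [Set.mem_ofPred_eq, tvDist] at ht
  have r1 := hlr.pow_row t v
  have r2 := hlr.psum
  set μ := (lazyKernel G c ^ t) v
  set π := statDist G c
  have s1 := Finset.sum_filter_add_sum_filter_not Finset.univ B μ
  have s2 := Finset.sum_filter_add_sum_filter_not Finset.univ B π
  have s3 := Finset.sum_filter_add_sum_filter_not Finset.univ B (fun x => |μ x - π x|)
  have a1 : ∑ x ∈ Finset.univ.filter B, (π x - μ x) ≤ ∑ x ∈ Finset.univ.filter B, |μ x - π x| :=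
    Finset.sum_le_sum fun x _ => by rw [abs_sub_comm]; exact le_abs_self _
  have a2 : ∑ x ∈ Finset.univ.filter (¬ B ·), (μ x - π x) ≤
      ∑ x ∈ Finset.univ.filter (¬ B ·), |μ x - π x| :=
    Finset.sum_le_sum fun x _ => le_abs_self _
  rw [Finset.sum_sub_distrib] at a1 a2
  linarith

end Network

section Transport

variable {V W : Type*} [Fintype V] [Fintype W]

lemma cs_equiv (e : V ≃ W) (G : SimpleGraph W) (c : W → W → ℝ) (v : V) :
    cs (G.comap e) (fun a b => c (e a) (e b)) v = cs G c (e v) := by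
  unfold cs
  refine Finset.sum_equiv e ?_ ?_
  · intro i; simp
  · intro i _; rfl

lemma kernel_equiv (e : V ≃ W) (G : SimpleGraph W) (c : W → W → ℝ) :
    lazyKernel (G.comap e) (fun a b => c (e a) (e b)) = (lazyKernel G c).submatrix e e := by
  funext a b
  have h := cs_equiv e G c a
  unfold cs at h
  simp only [SimpleGraph.comap_adj] at h
  simp only [lazyKernel, Matrix.submatrix_apply, h, SimpleGraph.comap_adj, e.injective.eq_iff]

lemma stat_equiv (e : V ≃ W) (G : SimpleGraph W) (c : W → W → ℝ) (v : V) :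
    statDist (G.comap e) (fun a b => c (e a) (e b)) v = statDist G c (e v) := by
  change cs (G.comap e) (fun a b => c (e a) (e b)) v /
    ∑ u, cs (G.comap e) (fun a b => c (e a) (e b)) u = cs G c (e v) / ∑ u, cs G c u
  simp only [cs_equiv e G c]
  rw [Equiv.sum_comp e (fun u => cs G c u)]

lemma mixing_equiv [DecidableEq V] [DecidableEq W] (e : V ≃ W) (G : SimpleGraph W)
    (c : W → W → ℝ) :
    mixingTime (G.comap e) (fun a b => c (e a) (e b)) = mixingTime G c := by
  have hp : ∀ t, ((lazyKernel G c).submatrix e e) ^ t = ((lazyKernel G c) ^ t).submatrix e e := by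
    intro t
    induction t with
    | zero => simp
    | succ t ih => rw [pow_succ, ih, pow_succ, Matrix.submatrix_mul_equiv]
  have h1 : ∀ v, mixingTimeFrom (G.comap e) (fun a b => c (e a) (e b)) v =
      mixingTimeFrom G c (e v) := by
    intro v
    unfold mixingTimeFrom tvDist
    simp only [kernel_equiv, hp, stat_equiv, Matrix.submatrix_apply]
    congr 1
    ext t
    rw [Set.mem_ofPred_eq, Set.mem_ofPred_eq,
      Equiv.sum_comp e (fun x => |(lazyKernel G c ^ t) (e v) x - statDist G c x|)]
  unfold mixingTime
  simp only [h1]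
  apply le_antisymm
  · exact Finset.sup_le fun v _ => Finset.le_sup (f := fun w => mixingTimeFrom G c w)
      (Finset.mem_univ (e v))
  · refine Finset.sup_le fun w _ => ?_
    have := Finset.le_sup (f := fun v => mixingTimeFrom G c (e v)) (Finset.mem_univ (e.symm w))
    simpa using this

end Transport
section Graph

/-- Words over an alphabet with eight letters; `c :: w` is a child of `w`. -/
abbrev Wd := List (Fin 8)

/-- Raw vertices: `T w i` lies at distance `i` from node `w` of the subdivided tree on the path
to its parent; `B w` is a node of the big tree. -/
inductive Raw where
  | T (w : Wd) (i : ℕ) : Raw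
  | B (w : Wd) : Raw

/-- Parameters of the construction. -/
structure Par where
  d : ℕ
  D : ℕ
  L : ℕ
  sp : Wd → Prop
  hdD : d ≤ D
  hL : 2 ≤ L
  hsp : ∀ w : Wd, w.length = d → sp w

namespace Par

variable (p : Par)

/-- Valid raw vertices. -/
def Valid : Raw → Prop
  | .T w i => w.length ≤ p.d ∧ i < p.L
  | .B w => w.length ≤ p.D

/-- The next vertex towards the root. -/
noncomputable def nxt : Raw → Option Raw
  | .T [] i => if i + 1 < p.L then some (.T [] (i + 1)) else none
  | .T (c :: w) i => if i + 1 < p.L then some (.T (c :: w) (i + 1)) else some (.T w 0)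
  | .B [] => none
  | .B (_ :: w) => some (.B w)

/-- The vertices below. -/
noncomputable def chd (c : Fin 8) : Raw → Option Raw
  | .T w 0 => if w.length < p.d then some (.T (c :: w) (p.L - 1)) else none
  | .T w (i + 1) => if c = 0 then some (.T w i) else none
  | .B w => if w.length < p.D then some (.B (c :: w)) else none

/-- The connector. -/
noncomputable def con : Raw → Option Raw
  | .T w i => if i = 0 ∧ p.sp w then some (.B w) else none
  | .B w => if w.length ≤ p.d ∧ p.sp w then some (.T w 0) else none

/-- All ports. -/
noncomputable def port : Fin 8 ⊕ Bool → Raw → Option Raw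
  | .inl c => p.chd c
  | .inr true => p.nxt
  | .inr false => p.con

/-- Height. -/
def ht : Raw → ℤ
  | .T w i => i - w.length * p.L
  | .B w => - w.length

/-- Side. -/
def side : Raw → Bool
  | .T _ _ => true
  | .B _ => false

variable {p}

lemma ht_nxt {x y : Raw} (hx : p.Valid x) (h : p.nxt x = some y) : p.ht y = p.ht x + 1 := by
  have := p.hL
  match x with
  | .T [] i => 
    simp only [nxt] at h
    split_ifs at h with h1
    · obtain rfl := Option.some.inj h
      simp [ht]
  | .T (c :: w) i => 
    simp only [nxt] at h
    split_ifs at h with h1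
    · obtain rfl := Option.some.inj h
      simp [ht]; ring
    · obtain rfl := Option.some.inj h
      have h2 := hx.2
      have h3 : p.L = i + 1 := by omega
      simp [ht, h3]; ring
  | .B [] => simp [nxt] at h
  | .B (c :: w) => 
    simp only [nxt] at h
    obtain rfl := Option.some.inj h
    simp [ht]

lemma side_nxt {x y : Raw} (h : p.nxt x = some y) : side y = side x := by
  match x with
  | .T [] i => 
    simp only [nxt] at h
    split_ifs at h with h1
    obtain rfl := Option.some.inj h
    rfl
  | .T (c :: w) i => 
    simp only [nxt] at h
    split_ifs at h with h1 <;> obtain rfl := Option.some.inj h <;> rfl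
  | .B [] => simp [nxt] at h
  | .B (c :: w) => 
    simp only [nxt] at h
    obtain rfl := Option.some.inj h
    rfl

lemma valid_nxt {x y : Raw} (hx : p.Valid x) (h : p.nxt x = some y) : p.Valid y := by
  have := p.hL
  match x with
  | .T [] i => 
    simp only [nxt] at h
    split_ifs at h with h1
    obtain rfl := Option.some.inj h
    exact ⟨hx.1, h1⟩
  | .T (c :: w) i => 
    simp only [nxt] at h
    have h0 := hx.1
    simp only [List.length_cons] at h0
    split_ifs at h with h1 <;> obtain rfl := Option.some.inj h
    · exact ⟨hx.1, h1⟩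
    · exact ⟨by omega, by omega⟩
  | .B [] => simp [nxt] at h
  | .B (c :: w) => 
    simp only [nxt] at h
    simp only [Valid, List.length_cons] at hx
    obtain rfl := Option.some.inj h
    simp only [Valid]; omega

lemma chd_valid {x y : Raw} {c : Fin 8} (hx : p.Valid x) (h : p.chd c x = some y) :
    p.Valid y ∧ p.nxt y = some x := by
  have := p.hL
  match x with
  | .T w 0 => 
    simp only [chd] at h
    split_ifs at h with h1
    obtain rfl := Option.some.inj h
    refine ⟨⟨by simp; omega, by omega⟩, ?_⟩
    simp only [nxt]
    rw [if_neg (by omega)]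
  | .T w (i+1) => 
    simp only [chd] at h
    split_ifs at h with h1
    obtain rfl := Option.some.inj h
    have h2 := hx.2
    refine ⟨⟨hx.1, by omega⟩, ?_⟩
    cases w <;> simp only [nxt] <;> rw [if_pos (by omega)]
  | .B w => 
    simp only [chd] at h
    split_ifs at h with h1
    obtain rfl := Option.some.inj h
    refine ⟨by simp [Valid]; omega, rfl⟩

lemma nxt_chd {x y : Raw} (hy : p.Valid y) (h : p.nxt y = some x) : ∃ c, p.chd c x = some y := by
  have := p.hL
  match y with
  | .T [] i => 
    simp only [nxt] at h
    split_ifs at h with h1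
    obtain rfl := Option.some.inj h
    exact ⟨0, by simp [chd]⟩
  | .T (c :: w) i => 
    simp only [nxt] at h
    have h0 := hy.1
    have h2 := hy.2
    simp only [List.length_cons] at h0
    split_ifs at h with h1 <;> obtain rfl := Option.some.inj h
    · exact ⟨0, by simp [chd]⟩
    · refine ⟨c, ?_⟩
      simp only [chd]
      rw [if_pos (by omega)]
      have : p.L - 1 = i := by omega
      rw [this]
  | .B [] => simp [nxt] at h
  | .B (c :: w) => 
    simp only [nxt] at h
    simp only [Valid, List.length_cons] at hy
    obtain rfl := Option.some.inj h
    exact ⟨c, by simp only [chd]; rw [if_pos (by omega)]⟩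

lemma chd_inj {x y : Raw} {c c' : Fin 8} (h : p.chd c x = some y) (h' : p.chd c' x = some y) :
    c = c' := by
  match x with
  | .T w 0 => 
    simp only [chd] at h h'
    split_ifs at h h' with h1
    obtain rfl := Option.some.inj h
    have := Option.some.inj h'
    simp at this
    exact this.symm
  | .T w (i+1) => 
    simp only [chd] at h h'
    split_ifs at h h' with h1
    simp_all
  | .B w => 
    simp only [chd] at h h'
    split_ifs at h h' with h1
    obtain rfl := Option.some.inj h
    have := Option.some.inj h'
    simp at this
    exact this.symm

lemma con_spec {x y : Raw} (hx : p.Valid x) (h : p.con x = some y) :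
    p.Valid y ∧ p.con y = some x ∧ side y ≠ side x := by
  have := p.hL
  have hdD := p.hdD
  match x with
  | .T w i => 
    simp only [con] at h
    split_ifs at h with h1
    obtain rfl := Option.some.inj h
    obtain ⟨rfl, h2⟩ := h1
    have h3 := hx.1
    refine ⟨by simp only [Valid]; omega, ?_, by simp [side]⟩
    simp only [con]
    rw [if_pos ⟨h3, h2⟩]
  | .B w => 
    simp only [con] at h
    split_ifs at h with h1
    obtain rfl := Option.some.inj h
    refine ⟨⟨h1.1, by omega⟩, ?_, by simp [side]⟩
    simp only [con]
    simp [h1.2]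

lemma nxt_asymm {x y : Raw} (hx : p.Valid x) (h : p.nxt x = some y) : p.nxt y ≠ some x := by
  intro h'
  have h1 := ht_nxt hx h
  have h2 := ht_nxt (valid_nxt hx h) h'
  omega

lemma port_valid {x y : Raw} (hx : p.Valid x) (q) (h : p.port q x = some y) : p.Valid y := by
  match q with
  | .inl c => exact (chd_valid hx h).1
  | .inr true => exact valid_nxt hx h
  | .inr false => exact (con_spec hx h).1

lemma port_symm {x y : Raw} (hx : p.Valid x) (q) (h : p.port q x = some y) :
    ∃ q', p.port q' y = some x := by
  match q with
  | .inl c => exact ⟨.inr true, (chd_valid hx h).2⟩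
  | .inr true => obtain ⟨c, hc⟩ := nxt_chd hx h; exact ⟨.inl c, hc⟩
  | .inr false => exact ⟨.inr false, (con_spec hx h).2.1⟩

lemma port_inj {x y : Raw} (hx : p.Valid x) (q q') (h : p.port q x = some y)
    (h' : p.port q' x = some y) : q = q' := by
  have hcn : ∀ c, p.chd c x = some y → p.nxt x ≠ some y :=
    fun c h1 h2 => nxt_asymm hx h2 (chd_valid hx h1).2
  have hcc : ∀ c, p.chd c x = some y → p.con x ≠ some y :=
    fun c h1 h2 => (con_spec hx h2).2.2 (side_nxt (chd_valid hx h1).2).symm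
  have hnc : p.nxt x = some y → p.con x ≠ some y :=
    fun h1 h2 => (con_spec hx h2).2.2 (side_nxt h1)
  match q, q' with
  | .inl c, .inl c' => rw [chd_inj h h']
  | .inl c, .inr true => exact absurd h' (hcn c h)
  | .inl c, .inr false => exact absurd h' (hcc c h)
  | .inr true, .inl c => exact absurd h (hcn c h')
  | .inr true, .inr true => rfl
  | .inr true, .inr false => exact absurd h' (hnc h)
  | .inr false, .inl c => exact absurd h (hcc c h')
  | .inr false, .inr true => exact absurd h (hnc h')
  | .inr false, .inr false => rfl

variable (p)

/-- Vertices. -/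
def Vt := {x : Raw // p.Valid x}

/-- Words of bounded length. -/
abbrev Wle (k : ℕ) := {w : Wd // w.length ≤ k}

instance wleFintype (k : ℕ) : Finite (Wle k) :=
  (List.finite_length_le (Fin 8) k).to_subtype

/-- Vertices as a sum type. -/
def vtEquiv : p.Vt ≃ (Wle p.d × Fin p.L) ⊕ Wle p.D where
  toFun x := match x with
    | ⟨.T w i, h⟩ => .inl (⟨w, h.1⟩, ⟨i, h.2⟩)
    | ⟨.B w, h⟩ => .inr ⟨w, h⟩
  invFun x := match x with
    | .inl (w, i) => ⟨.T w.1 i.1, w.2, i.2⟩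
    | .inr w => ⟨.B w.1, w.2⟩
  left_inv x := by
    match x with
    | ⟨.T w i, h⟩ => rfl
    | ⟨.B w, h⟩ => rfl
  right_inv x := by
    match x with
    | .inl (w, i) => rfl
    | .inr w => rfl

noncomputable instance vtFintype : Fintype p.Vt :=
  @Fintype.ofFinite _ (Finite.of_equiv _ p.vtEquiv.symm)

/-- The graph. -/
def Gr : SimpleGraph p.Vt where
  Adj x y := ∃ q, p.port q x.1 = some y.1
  symm := ⟨fun x _ ⟨q, h⟩ => port_symm x.2 q h⟩
  loopless := ⟨fun x ⟨q, h⟩ => by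
    match q with
    | .inl c => exact nxt_asymm x.2 (chd_valid x.2 h).2 (chd_valid x.2 h).2
    | .inr true => exact nxt_asymm x.2 h h
    | .inr false => exact (con_spec x.2 h).2.2 rfl⟩

lemma nb_sum (ψ : Raw → ℝ) (x : p.Vt) :
    ∑ u ∈ Finset.univ.filter (p.Gr.Adj x ·), ψ u.1 =
      (p.nxt x.1).elim 0 ψ + ∑ c, (p.chd c x.1).elim 0 ψ + (p.con x.1).elim 0 ψ := by
  have key : ∀ q, (p.port q x.1).elim 0 ψ =
      ∑ u : p.Vt, if p.port q x.1 = some u.1 then ψ u.1 else 0 := by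
    intro q
    rcases h : p.port q x.1 with _ | y
    · simp
    · have hy := port_valid x.2 q h
      rw [Finset.sum_eq_single ⟨y, hy⟩]
      · simp
      · intro b _ hb
        rw [if_neg]
        intro h'
        exact hb (Subtype.ext (Option.some.inj h').symm)
      · intro hn
        exact absurd (Finset.mem_univ _) hn
  have : ∑ q, (p.port q x.1).elim 0 ψ = ∑ u ∈ Finset.univ.filter (p.Gr.Adj x ·), ψ u.1 := by
    simp_rw [key]
    rw [Finset.sum_comm, Finset.sum_filter]
    refine Finset.sum_congr rfl fun u _ => ?_
    by_cases hu : p.Gr.Adj x u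
    · rw [if_pos hu]
      obtain ⟨q, hq⟩ := hu
      rw [Finset.sum_eq_single q]
      · rw [if_pos hq]
      · intro b _ hb
        rw [if_neg]
        intro h'
        exact hb (port_inj x.2 _ _ h' hq)
      · simp
    · rw [if_neg hu]
      refine Finset.sum_eq_zero fun q _ => ?_
      rw [if_neg]
      exact fun h' => hu ⟨q, h'⟩
  rw [← this, Fintype.sum_sum_type]
  simp only [port, Fintype.sum_bool]
  ring

lemma degree_le (x : p.Vt) : ({u | p.Gr.Adj x u} : Set p.Vt).ncard ≤ 10 := by
  have h := p.nb_sum (fun _ => 1) x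
  have e : ({u | p.Gr.Adj x u} : Set p.Vt) = ((Finset.univ.filter (p.Gr.Adj x ·) : Finset p.Vt) : Set p.Vt) := by
    ext; simp
  rw [e, Set.ncard_coe_finset]
  have h1 : ∀ o : Option Raw, o.elim (0:ℝ) (fun _ => 1) ≤ 1 := by
    intro o; cases o <;> simp
  have h2 : ∑ c, (p.chd c x.1).elim (0:ℝ) (fun _ => 1) ≤ ∑ c : Fin 8, 1 :=
    Finset.sum_le_sum fun c _ => h1 _
  rw [Finset.sum_const, nsmul_eq_mul, mul_one] at h
  have h3 := h1 (p.nxt x.1)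
  have h4 := h1 (p.con x.1)
  simp at h2
  have : ((Finset.univ.filter (p.Gr.Adj x ·) : Finset p.Vt).card : ℝ) ≤ 10 := by linarith
  exact_mod_cast this

/-- Left edges. -/
def lw : Wd → Prop
  | [] => False
  | c :: _ => c < 4

/-- Left vertices. -/
def lv : Raw → Prop
  | .T w _ => lw w
  | .B _ => False

/-- Conductance of the edges above a word. -/
noncomputable def cw (w : Wd) : ℝ := if lw w then 2 else 1

/-- The conductances. -/
noncomputable def cond (x y : Raw) : ℝ :=
  if (p.nxt x = some y ∧ lv x) ∨ (p.nxt y = some x ∧ lv y) then 2 else 1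

lemma cond_symm (x y : Raw) : p.cond x y = p.cond y x := by
  unfold cond; simp only [or_comm]

lemma cond_vals (x y : Raw) : p.cond x y = 1 ∨ p.cond x y = 2 := by
  unfold cond; split_ifs <;> simp

variable {p}

lemma cond_nxt {x y : Raw} (hx : p.Valid x) (h : p.nxt x = some y) :
    p.cond x y = if lv x then 2 else 1 := by
  unfold cond
  have := nxt_asymm hx h
  simp [h, this]

lemma cond_chd {x y : Raw} {c : Fin 8} (hx : p.Valid x) (h : p.chd c x = some y) :
    p.cond x y = if lv y then 2 else 1 := by
  rw [cond_symm]
  exact cond_nxt (chd_valid hx h).1 (chd_valid hx h).2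

lemma cond_con {x y : Raw} (hx : p.Valid x) (h : p.con x = some y) :
    p.cond x y = 1 := by
  have h3 := (con_spec hx h).2.2
  unfold cond
  rw [if_neg]
  rintro (⟨h1, _⟩ | ⟨h1, _⟩)
  · exact h3 (side_nxt h1)
  · exact h3 (side_nxt h1).symm

end Par

end Graph
section Drift

namespace Par

variable {p : Par}

/-- Conductance function attached to path conductances `K`. -/
structure CK (p : Par) (c : Raw → Raw → ℝ) (K : Wd → ℝ) : Prop where
  nxtT : ∀ w i y, p.Valid (.T w i) → p.nxt (.T w i) = some y → c (.T w i) y = K w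
  chdT : ∀ w i e v j, p.Valid (.T w i) → p.chd e (.T w i) = some (.T v j) →
    c (.T w i) (.T v j) = K v
  nxtB : ∀ w y, p.Valid (.B w) → p.nxt (.B w) = some y → c (.B w) y = 1
  chdB : ∀ w e y, p.Valid (.B w) → p.chd e (.B w) = some y → c (.B w) y = 1
  con : ∀ x y, p.Valid x → p.con x = some y → c x y = 1

lemma ck_unit (p : Par) : CK p (fun _ _ => 1) (fun _ => 1) :=
  ⟨fun _ _ _ _ _ => rfl, fun _ _ _ _ _ _ _ => rfl, fun _ _ _ _ => rfl, fun _ _ _ _ _ => rfl,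
    fun _ _ _ _ => rfl⟩

lemma ck_cond (p : Par) : CK p p.cond cw := by
  refine ⟨fun w i y hx h => cond_nxt hx h, fun w i e v j hx h => cond_chd hx h,
    fun w y hx h => ?_, fun w e y hx h => ?_, fun x y hx h => cond_con hx h⟩
  · rw [cond_nxt hx h, if_neg]; exact id
  · rw [cond_chd hx h, if_neg]
    simp only [chd] at h
    split_ifs at h
    obtain rfl := Option.some.inj h
    exact id

/-- Value at the parent. -/
def pv (N : Wd → ℝ) (ex : ℝ) : Wd → ℝ
  | [] => N [] + ex
  | _ :: w => N w

/-- Contribution of the parent in the big tree. -/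
def pb (b : Wd → ℝ) (η : ℝ) : Wd → ℝ
  | [] => 0
  | e :: u => b u - b (e :: u) - 2 * η

/-- Interpolated function. -/
noncomputable def fn (p : Par) (N b : Wd → ℝ) (ex η : ℝ) : Raw → ℝ
  | .T w i => N w + (pv N ex w - N w) * i / p.L - 2 * η * i * (p.L - i)
  | .B w => b w

lemma sum_if (P : Prop) [Decidable P] (f : Fin 8 → ℝ) :
    (∑ e, if P then f e else 0) = if P then ∑ e, f e else 0 := by
  split_ifs <;> simp

theorem drift_of {c : Raw → Raw → ℝ} {K : Wd → ℝ} (hc : CK p c K) (hK : ∀ w, 0 ≤ K w)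
    (N b : Wd → ℝ) (ex η : ℝ) (ok : Wd → Prop)
    (hex : - ex ≤ 2 * η * p.L * (p.L - 2))
    (hT : ∀ w : Wd, w.length ≤ p.d →
      K w * ((pv N ex w - N w) / p.L - 2 * η * p.L) +
      (if w.length < p.d then ∑ e : Fin 8, K (e :: w) * ((N (e :: w) - N w) / p.L - 2 * η * p.L)
        else 0) + (if p.sp w then b w - N w - 2 * η else 0) ≤ 0)
    (hB : ∀ w : Wd, w.length ≤ p.D → ok w →
      pb b η w +
      (if w.length < p.D then ∑ e : Fin 8, (b (e :: w) - b w - 2 * η) else 0) +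
      (if w.length ≤ p.d ∧ p.sp w then N w - b w - 2 * η else 0) ≤ 0)
    (x : p.Vt) (hx : ∀ w, x.1 = .B w → ok w) :
    ∑ u ∈ Finset.univ.filter (p.Gr.Adj x ·),
      c x.1 u.1 * (fn p N b ex η u.1 - fn p N b ex η x.1) ≤
        2 * η * cs p.Gr (fun a b : p.Vt => c a.1 b.1) x := by
  unfold cs
  rw [Finset.mul_sum, ← sub_nonpos, ← Finset.sum_sub_distrib,
    p.nb_sum (fun u => c x.1 u * (fn p N b ex η u - fn p N b ex η x.1) - 2 * η * c x.1 u)]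
  have hL := p.hL
  have hL0 : (p.L : ℝ) ≠ 0 := by
    have : p.L ≠ 0 := by omega
    exact_mod_cast this
  have hLp : (0:ℝ) < p.L := lt_of_le_of_ne (Nat.cast_nonneg _) hL0.symm
  obtain ⟨x, hv⟩ := x
  match x with
  | .T w 0 =>
    have hnx : (p.nxt (.T w 0)) = some (.T w 1) := by
      cases w <;> simp only [nxt] <;> rw [if_pos (by omega)]
    have h1 := hc.nxtT w 0 _ hv hnx
    have h2 : ∀ e, (p.chd e (.T w 0)).elim 0 (fun u => c (.T w 0) u *
        (fn p N b ex η u - fn p N b ex η (.T w 0)) - 2 * η * c (.T w 0) u) =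
        if w.length < p.d then K (e :: w) * ((N (e :: w) - N w) / p.L - 2 * η * p.L) else 0 := by
      intro e
      by_cases hw : w.length < p.d
      · have hce : p.chd e (.T w 0) = some (.T (e :: w) (p.L - 1)) := by
          simp only [chd]; rw [if_pos hw]
        rw [if_pos hw, hce]
        simp only [Option.elim]
        rw [hc.chdT _ _ _ _ _ hv hce]
        have : ((p.L - 1 : ℕ) : ℝ) = p.L - 1 := by
          rw [Nat.cast_sub (by omega)]; simp
        simp only [fn, pv, this]
        field_simp
        push_cast
        ring
      · have hce : p.chd e (.T w 0) = none := by
          simp only [chd]; rw [if_neg hw]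
        rw [if_neg hw, hce]; rfl
    have h3 : (p.con (.T w 0)).elim 0 (fun u => c (.T w 0) u *
        (fn p N b ex η u - fn p N b ex η (.T w 0)) - 2 * η * c (.T w 0) u) =
        if p.sp w then b w - N w - 2 * η else 0 := by
      by_cases hw : p.sp w
      · have hce : p.con (.T w 0) = some (.B w) := by
          simp [con, hw]
        rw [if_pos hw, hce]
        simp only [Option.elim]
        rw [hc.con _ _ hv hce]
        simp [fn]
      · have hce : p.con (.T w 0) = none := by
          simp [con, hw]
        rw [if_neg hw, hce]; rfl
    simp only [h2, h3, hnx]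
    simp only [Option.elim]
    rw [h1]
    have h4 := hT w hv.1
    have e1 : K w * (fn p N b ex η (.T w 1) - fn p N b ex η (.T w 0)) - 2 * η * K w =
        K w * ((pv N ex w - N w) / p.L - 2 * η * p.L) := by
      simp only [fn]
      push_cast
      ring
    rw [e1, sum_if]
    exact h4
  | .T w (i+1) =>
    have hch : ∀ e, p.chd e (.T w (i+1)) = if e = 0 then some (.T w i) else none := by
      intro e; rfl
    have hcon : p.con (.T w (i+1)) = none := by simp [con]
    have hc0 := hc.chdT w (i+1) 0 w i hv (by simp [hch])
    have h2 : ∑ e, (p.chd e (.T w (i+1))).elim 0 (fun u => c (.T w (i+1)) u *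
        (fn p N b ex η u - fn p N b ex η (.T w (i+1))) - 2 * η * c (.T w (i+1)) u) =
        K w * (fn p N b ex η (.T w i) - fn p N b ex η (.T w (i+1))) - 2 * η * K w := by
      rw [Finset.sum_eq_single 0]
      · simp [hch, hc0]
      · intro e _ he
        simp [hch, he]
      · intro h; exact absurd (Finset.mem_univ _) h
    have h2v := hv.2
    simp only [h2, hcon]
    by_cases hend : w = [] ∧ ¬ (i + 1 + 1 < p.L)
    · obtain ⟨rfl, hi⟩ := hend
      have hnx : p.nxt (.T [] (i+1)) = none := by
        simp only [nxt]; rw [if_neg hi]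
      rw [hnx]
      simp only [Option.elim, fn, pv]
      have hi2 : (p.L : ℝ) = i + 2 := by
        have : p.L = i + 2 := by omega
        rw [this]; push_cast; ring
      push_cast
      have : 0 ≤ K [] := hK _
      have e2 : K [] * (N [] + (N [] + ex - N []) * i / p.L - 2 * η * i * (p.L - i) -
        (N [] + (N [] + ex - N []) * (i + 1) / p.L - 2 * η * (i + 1) * (p.L - (i + 1)))) - 2 * η * K []
        = K [] * ((- ex - 2 * η * p.L * (p.L - 2)) / p.L) := by
        have : (i : ℝ) = p.L - 2 := by linarith
        rw [this]
        field_simp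
        ring
      rw [zero_add, add_zero, e2]
      exact mul_nonpos_of_nonneg_of_nonpos this (div_nonpos_of_nonpos_of_nonneg (by linarith) hLp.le)
    · have : ∃ y, p.nxt (.T w (i+1)) = some y ∧ fn p N b ex η y =
        N w + (pv N ex w - N w) * (i + 2) / p.L - 2 * η * (i + 2) * (p.L - (i + 2)) := by
        by_cases hi : i + 1 + 1 < p.L
        · refine ⟨.T w (i + 1 + 1), ?_, ?_⟩
          · cases w <;> simp only [nxt] <;> rw [if_pos hi]
          · simp only [fn]; push_cast; ring
        · have hi2 : (p.L : ℝ) = i + 2 := by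
            have : p.L = i + 2 := by omega
            rw [this]; push_cast; ring
          match w with
          | [] => simp [hi] at hend
          | e :: v =>
            refine ⟨.T v 0, ?_, ?_⟩
            · simp only [nxt]; rw [if_neg hi]
            · simp only [fn, pv]
              rw [← hi2]
              field_simp
              simp [mul_comm]
      obtain ⟨y, hy1, hy2⟩ := this
      rw [hy1]
      simp only [Option.elim]
      rw [hc.nxtT _ _ _ hv hy1, hy2]
      simp only [fn]
      push_cast
      apply le_of_eq
      ring
  | .B w =>
    have h2 : ∀ e, (p.chd e (.B w)).elim 0 (fun u => c (.B w) u *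
        (fn p N b ex η u - fn p N b ex η (.B w)) - 2 * η * c (.B w) u) =
        if w.length < p.D then b (e :: w) - b w - 2 * η else 0 := by
      intro e
      by_cases hw : w.length < p.D
      · have hce : p.chd e (.B w) = some (.B (e :: w)) := by
          simp only [chd]; rw [if_pos hw]
        rw [if_pos hw, hce]
        simp only [Option.elim]
        rw [hc.chdB _ _ _ hv hce]
        simp [fn]
      · have hce : p.chd e (.B w) = none := by
          simp only [chd]; rw [if_neg hw]
        rw [if_neg hw, hce]; rfl
    have h3 : (p.con (.B w)).elim 0 (fun u => c (.B w) u *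
        (fn p N b ex η u - fn p N b ex η (.B w)) - 2 * η * c (.B w) u) =
        if w.length ≤ p.d ∧ p.sp w then N w - b w - 2 * η else 0 := by
      by_cases hw : w.length ≤ p.d ∧ p.sp w
      · have hce : p.con (.B w) = some (.T w 0) := by
          simp [con, hw]
        rw [if_pos hw, hce]
        simp only [Option.elim]
        rw [hc.con _ _ hv hce]
        simp [fn]
      · have hce : p.con (.B w) = none := by
          simp only [con]; rw [if_neg hw]
        rw [if_neg hw, hce]; rfl
    have h4 : (p.nxt (.B w)).elim 0 (fun u => c (.B w) u *
        (fn p N b ex η u - fn p N b ex η (.B w)) - 2 * η * c (.B w) u) =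
        pb b η w := by
      match w with
      | [] => rfl
      | e :: v =>
        have hce : p.nxt (.B (e :: v)) = some (.B v) := rfl
        rw [hce]
        simp only [Option.elim]
        rw [hc.nxtB _ _ hv hce]
        simp [fn, pb]
    have h5 := hB w hv (hx w rfl)
    simp only [h2, h3, h4]
    rw [sum_if]
    exact h5

end Par

end Drift
section Biased

namespace Par

/-- The biased height of a word. -/
def Xw : Wd → ℕ
  | [] => 0
  | c :: w => if c < 4 then Xw w + 7 else Xw w - 10

/-- The parameters. -/
def mk' (d m : ℕ) : Par where
  d := d
  D := 2 * d + 6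
  L := 8 ^ (d + 4)
  sp w := m ≤ Xw w ∨ w.length = d
  hdD := by omega
  hL := by
    calc 2 ≤ 8 ^ 1 := by norm_num
      _ ≤ 8 ^ (d + 4) := Nat.pow_le_pow_right (by norm_num) (by omega)
  hsp _ h := Or.inr h

/-- Length of the paths, as a real number. -/
noncomputable def Lr (d : ℕ) : ℝ := 8 ^ (d + 4)

/-- Auxiliary constant. -/
noncomputable def Sr (d m : ℕ) : ℝ := 6000 * m * Lr d

/-- Increments on the big tree. -/
noncomputable def dl (d m k : ℕ) : ℝ :=
  6 * 8 ^ (2 * d + 6 - k) - 3 + Sr d m / 7 * (8 ^ (d + 1 - k) - 1)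

/-- Values on the big tree. -/
noncomputable def fB (d m : ℕ) : ℕ → ℝ
  | 0 => 0
  | k + 1 => fB d m k + dl d m (k + 1)

lemma Lr_ge (d : ℕ) : 4096 ≤ Lr d := by
  unfold Lr
  calc (4096 : ℝ) = 8 ^ 4 := by norm_num
    _ ≤ 8 ^ (d + 4) := pow_le_pow_right₀ (by norm_num) (by omega)

lemma Sr_nn (d m : ℕ) : 0 ≤ Sr d m := by
  have := Lr_ge d
  unfold Sr; positivity

lemma dl_nn (d m k : ℕ) : 0 ≤ dl d m k := by
  unfold dl
  have h1 : (1:ℝ) ≤ 8 ^ (2 * d + 6 - k) := one_le_pow₀ (by norm_num)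
  have h2 : (1:ℝ) ≤ 8 ^ (d + 1 - k) := one_le_pow₀ (by norm_num)
  have := mul_nonneg (div_nonneg (Sr_nn d m) (by norm_num : (0:ℝ) ≤ 7)) (sub_nonneg.2 h2)
  linarith

lemma fB_nn (d m k : ℕ) : 0 ≤ fB d m k := by
  induction k with
  | zero => exact le_rfl
  | succ k ih => exact add_nonneg ih (dl_nn _ _ _)

lemma dl_step (d m k : ℕ) (hk : k < 2 * d + 6) :
    - dl d m k + 8 * dl d m (k + 1) + (if k ≤ d then Sr d m else 0) ≤ - 21 := by
  unfold dl
  have e1 : (8:ℝ) ^ (2 * d + 6 - k) = 8 * 8 ^ (2 * d + 6 - (k + 1)) := by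
    rw [← pow_succ']; congr 1; omega
  split_ifs with h
  · have e2 : (8:ℝ) ^ (d + 1 - k) = 8 * 8 ^ (d + 1 - (k + 1)) := by
      rw [← pow_succ']; congr 1; omega
    rw [e1, e2]; apply le_of_eq; ring
  · have e2 : d + 1 - k = 0 := by omega
    have e3 : d + 1 - (k + 1) = 0 := by omega
    rw [e1, e2, e3]; apply le_of_eq; ring

lemma fB_le0 (d m k : ℕ) (hk : k ≤ 2 * d + 6) :
    fB d m k ≤ 6 / 7 * (8 ^ (2 * d + 6) - 8 ^ (2 * d + 6 - k)) +
      Sr d m / 49 * (8 ^ (d + 1) - 8 ^ (d + 1 - k)) := by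
  induction k with
  | zero => simp [fB]
  | succ k ih =>
    have ih := ih (by omega)
    unfold fB
    have hS := Sr_nn d m
    have e1 : (8:ℝ) ^ (2 * d + 6 - k) = 8 * 8 ^ (2 * d + 6 - (k + 1)) := by
      rw [← pow_succ']; congr 1; omega
    unfold dl
    rw [e1] at ih
    by_cases h : k ≤ d
    · have e2 : (8:ℝ) ^ (d + 1 - k) = 8 * 8 ^ (d + 1 - (k + 1)) := by
        rw [← pow_succ']; congr 1; omega
      rw [e2] at ih
      nlinarith
    · have e2 : d + 1 - k = 0 := by omega
      have e3 : d + 1 - (k + 1) = 0 := by omega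
      rw [e2] at ih
      rw [e3]
      nlinarith

lemma fB_le (d m k : ℕ) (hm : 1 ≤ m) (hk : k ≤ 2 * d + 6) :
    fB d m k + Sr d m ≤ 3 * m * Lr d ^ 2 := by
  have h := fB_le0 d m k hk
  have hS := Sr_nn d m
  have h1 : (0:ℝ) ≤ 8 ^ (2 * d + 6 - k) := by positivity
  have h2 : (0:ℝ) ≤ Sr d m / 49 * 8 ^ (d + 1 - k) := by positivity
  have e1 : (8:ℝ) ^ (2 * d + 6) = Lr d ^ 2 / 64 := by
    unfold Lr; rw [← pow_mul, show (d + 4) * 2 = 2 * d + 6 + 2 by ring, pow_add _ (2 * d + 6)]; norm_num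
  have e2 : (8:ℝ) ^ (d + 1) = Lr d / 512 := by
    unfold Lr; rw [show d + 4 = d + 1 + 3 by ring, pow_add _ (d + 1)]; norm_num
  rw [e1, e2] at h
  have hm' : (1:ℝ) ≤ m := by exact_mod_cast hm
  have hL := Lr_ge d
  have e3 : Sr d m / 49 * (Lr d / 512) = (6000 / (49 * 512)) * (m * Lr d ^ 2) := by
    unfold Sr; ring
  have e4 : Sr d m ≤ 2 * (m * Lr d ^ 2) := by
    unfold Sr
    have : 0 ≤ m * Lr d * (Lr d - 4096) := by
      apply mul_nonneg (by positivity); linarith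
    nlinarith
  have e5 : Lr d ^ 2 ≤ m * Lr d ^ 2 := by
    nlinarith [sq_nonneg (Lr d)]
  have e6 := sq_nonneg (Lr d)
  nlinarith

/-- Node values of the Lyapunov function. -/
noncomputable def Nb (d m : ℕ) (w : Wd) : ℝ :=
  if m ≤ Xw w ∨ w.length = d then fB d m w.length + Sr d m
  else 153 * m * Lr d ^ 2 + 14 * Lr d ^ 2 * (m - Xw w)

variable {d m : ℕ}

lemma Nb_nn (w : Wd) : 0 ≤ Nb d m w := by
  unfold Nb
  split_ifs with h
  · exact add_nonneg (fB_nn _ _ _) (Sr_nn _ _)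
  · push Not at h
    have : (Xw w : ℝ) ≤ m := by exact_mod_cast h.1.le
    have : (0:ℝ) ≤ m - Xw w := by linarith
    positivity

lemma Nb_le (hm : 1 ≤ m) {w : Wd} (hw : w.length ≤ d) (hX : Xw w ≤ m + 10) :
    Nb d m w ≤ 153 * m * Lr d ^ 2 + 14 * Lr d ^ 2 * (m - Xw w) := by
  unfold Nb
  split_ifs with h
  · have h1 := fB_le d m w.length hm (by omega)
    have hX' : (Xw w : ℝ) ≤ m + 10 := by exact_mod_cast hX
    have hm' : (1:ℝ) ≤ m := by exact_mod_cast hm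
    have h2 : 0 ≤ Lr d ^ 2 := sq_nonneg _
    nlinarith [mul_nonneg h2 (sub_nonneg.2 hX'), mul_nonneg h2 (sub_nonneg.2 hm')]
  · exact le_rfl

lemma Nb_le' (hm : 1 ≤ m) {w : Wd} (hw : w.length ≤ d) :
    Nb d m w ≤ 167 * m * Lr d ^ 2 := by
  have h0 : (0:ℝ) ≤ m * Lr d ^ 2 := by positivity
  unfold Nb
  split_ifs with h
  · have h1 := fB_le d m w.length hm (by omega)
    linarith
  · have : (0:ℝ) ≤ Xw w := Nat.cast_nonneg _
    have h2 : 0 ≤ Lr d ^ 2 := sq_nonneg _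
    nlinarith

lemma pv_nn (w : Wd) : 0 ≤ pv (Nb d m) (2 * Lr d ^ 2) w := by
  cases w with
  | nil => exact add_nonneg (Nb_nn _) (by positivity)
  | cons e u => exact Nb_nn _

lemma pv_le (hm : 1 ≤ m) {w : Wd} (hw : w.length ≤ d) :
    pv (Nb d m) (2 * Lr d ^ 2) w ≤ 169 * m * Lr d ^ 2 := by
  have h0 : (0:ℝ) ≤ m * Lr d ^ 2 := by positivity
  have hm' : (1:ℝ) ≤ m := by exact_mod_cast hm
  cases w with
  | nil =>
    have h1 := Nb_le' hm (w := []) hw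
    have : Lr d ^ 2 ≤ m * Lr d ^ 2 := by nlinarith [sq_nonneg (Lr d)]
    simp only [pv]
    nlinarith
  | cons e u =>
    have h1 := Nb_le' hm (d := d) (w := u) (by simp at hw; omega)
    simp only [pv]
    linarith

lemma cw_vals (w : Wd) : 0 ≤ cw w ∧ cw w ≤ 2 := by
  unfold cw; split_ifs <;> norm_num

lemma mk_L (d m : ℕ) : ((mk' d m).L : ℝ) = Lr d := by
  simp [mk', Lr]

/-- The children part at a nonspecial node. -/
lemma children_le (hm : 1 ≤ m) {w : Wd} (hw : w.length < d) (hX : Xw w < m) :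
    ∑ e : Fin 8, cw (e :: w) * (Nb d m (e :: w) - Nb d m w + 2 * Lr d ^ 2) ≤ - 200 * Lr d ^ 2 := by
  have h2 : 0 ≤ Lr d ^ 2 := sq_nonneg _
  have hN : Nb d m w = 153 * m * Lr d ^ 2 + 14 * Lr d ^ 2 * (m - Xw w) := by
    unfold Nb; rw [if_neg]; push Not; exact ⟨hX, by omega⟩
  have hc : ∀ e : Fin 8, cw (e :: w) * (Nb d m (e :: w) - Nb d m w + 2 * Lr d ^ 2) ≤
      if e < 4 then - 192 * Lr d ^ 2 else 142 * Lr d ^ 2 := by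
    intro e
    by_cases he : e < 4
    · have hx : Xw (e :: w) = Xw w + 7 := by simp [Xw, he]
      have h1 := Nb_le (d := d) hm (w := e :: w) (by simp; omega) (by omega)
      have hcw : cw (e :: w) = 2 := by simp [cw, lw, he]
      rw [if_pos he, hcw, hN]
      rw [hx] at h1
      push_cast at h1
      linarith
    · have hx : Xw (e :: w) = Xw w - 10 := by simp [Xw, he]
      have h1 := Nb_le (d := d) hm (w := e :: w) (by simp; omega) (by omega)
      have hcw : cw (e :: w) = 1 := by simp [cw, lw, he]
      rw [if_neg he, hcw, hN]
      have h3 : (Xw w : ℝ) ≤ Xw (e :: w) + 10 := by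
        have : Xw w ≤ Xw (e :: w) + 10 := by omega
        exact_mod_cast this
      nlinarith
  refine (Finset.sum_le_sum fun e _ => hc e).trans ?_
  have : (∑ e : Fin 8, if e < 4 then - 192 * Lr d ^ 2 else 142 * Lr d ^ 2) = -200 * Lr d ^ 2 := by
    rw [Fin.sum_univ_eight]
    norm_num [Fin.lt_def]
    ring
  exact this.le

lemma parent_le (hm : 1 ≤ m) {w : Wd} (hw : w.length < d) (hX : Xw w < m) :
    cw w * (pv (Nb d m) (2 * Lr d ^ 2) w - Nb d m w + 2 * Lr d ^ 2) ≤ 200 * Lr d ^ 2 := by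
  have h2 : 0 ≤ Lr d ^ 2 := sq_nonneg _
  have hN : Nb d m w = 153 * m * Lr d ^ 2 + 14 * Lr d ^ 2 * (m - Xw w) := by
    unfold Nb; rw [if_neg]; push Not; exact ⟨hX, by omega⟩
  match w with
  | [] =>
    simp only [pv, cw, lw]
    simp
    linarith
  | e :: u =>
    simp only [List.length_cons] at hw
    simp only [pv]
    by_cases he : e < 4
    · have hx : Xw (e :: u) = Xw u + 7 := by simp [Xw, he]
      have h1 := Nb_le (d := d) hm (w := u) (by omega) (by omega)
      have hcw : cw (e :: u) = 2 := by simp [cw, lw, he]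
      rw [hcw, hN]
      rw [hx]
      push_cast
      linarith
    · have hx : Xw (e :: u) = Xw u - 10 := by simp [Xw, he]
      have h1 := Nb_le (d := d) hm (w := u) (by omega) (by omega)
      have hcw : cw (e :: u) = 1 := by simp [cw, lw, he]
      rw [hcw, hN]
      have h3 : (Xw (e :: u) : ℝ) ≤ Xw u := by
        have : Xw (e :: u) ≤ Xw u := by omega
        exact_mod_cast this
      nlinarith

lemma special_le (hm : 1 ≤ m) (w : Wd) (A B : ℝ) (hA : A ≤ 169 * m * Lr d ^ 2) (hB : 0 ≤ B) :
    cw w * ((A - B) / Lr d - 2 * (-1) * Lr d) ≤ 342 * m * Lr d := by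
  have hL := Lr_ge d
  have hm' : (1:ℝ) ≤ m := by exact_mod_cast hm
  obtain ⟨h1, h2⟩ := cw_vals w
  have h3 : (A - B) / Lr d ≤ 169 * m * Lr d := by
    rw [div_le_iff₀ (by linarith)]; nlinarith
  have h4 : Lr d ≤ m * Lr d := by nlinarith
  have h5 : (A - B) / Lr d - 2 * (-1) * Lr d ≤ 171 * m * Lr d := by linarith
  have h6 : 0 ≤ m * Lr d := by positivity
  nlinarith [mul_le_mul_of_nonneg_left h5 h1]

theorem biased_T (hm : 1 ≤ m) (w : Wd) (hw : w.length ≤ d) :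
    cw w * ((pv (Nb d m) (2 * Lr d ^ 2) w - Nb d m w) / Lr d - 2 * (-1) * Lr d) +
      (if w.length < d then ∑ e : Fin 8, cw (e :: w) *
        ((Nb d m (e :: w) - Nb d m w) / Lr d - 2 * (-1) * Lr d)
        else 0) +
      (if (mk' d m).sp w then fB d m w.length - Nb d m w - 2 * (-1) else 0) ≤ 0 := by
  have hL := Lr_ge d
  have hm' : (1:ℝ) ≤ m := by exact_mod_cast hm
  have hL0 : Lr d ≠ 0 := by linarith
  by_cases hs : m ≤ Xw w ∨ w.length = d
  · have hN : Nb d m w = fB d m w.length + Sr d m := by unfold Nb; rw [if_pos hs]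
    have h1 := special_le hm w _ _ (pv_le hm hw) (Nb_nn (d := d) (m := m) w)
    have h2 : (if w.length < d then ∑ e : Fin 8, cw (e :: w) *
        ((Nb d m (e :: w) - Nb d m w) / Lr d - 2 * (-1) * Lr d) else 0) ≤ 8 * (342 * m * Lr d) := by
      split_ifs with h
      · calc _ ≤ ∑ e : Fin 8, 342 * m * Lr d := Finset.sum_le_sum fun e _ =>
              special_le hm (e :: w) _ _ (by
                have := Nb_le' (d := d) hm (w := e :: w) (by simp; omega)
                have h0 : (0:ℝ) ≤ m * Lr d ^ 2 := by positivity
                linarith) (Nb_nn w)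
          _ = _ := by simp
      · positivity
    rw [if_pos (show (mk' d m).sp w from hs), hN] at *
    have : 4096 ≤ m * Lr d := by nlinarith
    unfold Sr at *
    linarith
  · rw [if_neg (show ¬ (mk' d m).sp w from hs)]
    push Not at hs
    have h1 : w.length < d := by omega
    rw [if_pos h1]
    have h2 := parent_le hm h1 hs.1
    have h3 := children_le hm h1 hs.1
    have e1 : ∀ a b : ℝ, a * (b / Lr d - 2 * (-1) * Lr d) = (a * (b + 2 * Lr d ^ 2)) / Lr d := by
      intro a b; field_simp; ring
    simp only [e1]
    rw [← Finset.sum_div, ← add_div, add_zero]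
    apply div_nonpos_of_nonpos_of_nonneg _ (by linarith)
    linarith

theorem biased_B (w : Wd) (hw : w.length ≤ 2 * d + 6) (hne : w ≠ []) :
    pb (fun w => fB d m w.length) (-1) w +
      (if w.length < 2 * d + 6 then ∑ e : Fin 8,
        (fB d m (e :: w).length - fB d m w.length - 2 * (-1)) else 0) +
      (if w.length ≤ d ∧ (mk' d m).sp w
        then Nb d m w - fB d m w.length - 2 * (-1) else 0) ≤ 0 := by
  match w with
  | e :: u =>
    simp only [List.length_cons] at hw
    have hS := Sr_nn d m
    have h3 : (if (e :: u).length ≤ d ∧ (mk' d m).sp (e :: u)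
        then Nb d m (e :: u) - fB d m (e :: u).length - 2 * (-1) else 0) ≤
        (if u.length + 1 ≤ d then Sr d m + 2 else 0) := by
      split_ifs with h h' h'
      · unfold Nb; rw [if_pos (show m ≤ Xw (e :: u) ∨ (e :: u).length = d from h.2)]; linarith
      · exact absurd h.1 h'
      · linarith
      · exact le_rfl
    refine (add_le_add le_rfl h3).trans ?_
    simp only [pb, List.length_cons, fB]
    by_cases hlt : u.length + 1 < 2 * d + 6
    · rw [if_pos hlt]
      have h := dl_step d m (u.length + 1) hlt
      simp only [Finset.sum_const, Finset.card_univ, Fintype.card_fin, nsmul_eq_mul]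
      push_cast
      split_ifs at h ⊢ <;> linarith
    · rw [if_neg hlt, if_neg (by omega)]
      have h1 : 2 * d + 6 - (u.length + 1) = 0 := by omega
      have h2 : d + 1 - (u.length + 1) = 0 := by omega
      unfold dl
      rw [h1, h2]
      norm_num

/-- The root of the big tree. -/
def oB (p : Par) : p.Vt := ⟨.B [], Nat.zero_le _⟩

/-- Rank. -/
def rk (p : Par) : Raw → ℕ
  | .T w i => p.D + 1 + (p.d - w.length) * p.L + i
  | .B w => w.length

lemma rank_dec (p : Par) (x : p.Vt) (hx : x ≠ oB p) :
    ∃ y, p.Gr.Adj x y ∧ rk p y.1 < rk p x.1 := by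
  obtain ⟨x, hv⟩ := x
  have hL := p.hL
  match x with
  | .B [] => exact absurd rfl hx
  | .B (e :: w) =>
    refine ⟨⟨.B w, by simp [Valid] at hv ⊢; omega⟩, ⟨.inr true, rfl⟩, ?_⟩
    simp [rk]
  | .T w (i+1) =>
    refine ⟨⟨.T w i, hv.1, by have := hv.2; omega⟩, ⟨.inl 0, by simp [port, chd]⟩, ?_⟩
    simp [rk]
  | .T w 0 =>
    have hw := hv.1
    have hD := p.hdD
    by_cases h : w.length < p.d
    · refine ⟨⟨.T (0 :: w) (p.L - 1), by simp; omega, by omega⟩, ⟨.inl 0, by simp [port, chd, h]⟩, ?_⟩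
      simp only [rk, List.length_cons]
      have : (p.d - w.length) * p.L = (p.d - (w.length + 1)) * p.L + p.L := by
        rw [← Nat.succ_mul]; congr 1; omega
      omega
    · have hs := p.hsp w (by omega)
      refine ⟨⟨.B w, by simp [Valid]; omega⟩, ⟨.inr false, by simp [port, con, hs]⟩, ?_⟩
      simp only [rk]
      omega

instance (p : Par) : Nonempty p.Vt := ⟨oB p⟩

lemma nbr_ex (p : Par) (x : p.Vt) : ∃ y, p.Gr.Adj x y := by
  by_cases hx : x = oB p
  · subst hx
    by_cases hD : 0 < p.D
    · exact ⟨⟨.B [0], by simp [Valid]; omega⟩, .inl 0, by simp [port, chd, oB, hD]⟩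
    · have := p.hdD
      have := p.hL
      have hs := p.hsp [] (by simp; omega)
      exact ⟨⟨.T [] 0, by simp, by omega⟩, .inr false, by simp [port, con, oB, hs]⟩
  · obtain ⟨y, hy, _⟩ := rank_dec p x hx
    exact ⟨y, hy⟩

lemma good_cond (p : Par) : Good p.Gr (fun a b : p.Vt => p.cond a.1 b.1) :=
  ⟨fun _ _ => p.cond_symm _ _, fun u v _ => by
    rcases p.cond_vals u.1 v.1 with h | h <;> rw [h] <;> norm_num, nbr_ex p⟩

lemma good_unit (p : Par) : Good p.Gr (fun _ _ : p.Vt => 1) :=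
  ⟨fun _ _ => rfl, fun _ _ _ => one_pos, nbr_ex p⟩

theorem cond_upper [DecidableEq (mk' d m).Vt] (hm : 1 ≤ m) :
    mixingTime (mk' d m).Gr (fun a b : (mk' d m).Vt => (mk' d m).cond a.1 b.1) ≤
      3200 * m * (8 ^ (d + 4)) ^ 2 := by
  have hL := Lr_ge d
  have hpL : ((mk' d m).L : ℝ) = Lr d := mk_L d m
  have hm' : (1:ℝ) ≤ m := by exact_mod_cast hm
  have h0 : (0:ℝ) ≤ m * Lr d ^ 2 := by positivity
  have hLm : Lr d ^ 2 ≤ m * Lr d ^ 2 := by nlinarith [sq_nonneg (Lr d)]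
  have hpath : ∀ w i, (mk' d m).Valid (.T w i) → 0 ≤ (i : ℝ) / Lr d ∧ (i : ℝ) / Lr d ≤ 1 ∧
      0 ≤ 2 * (i : ℝ) * (Lr d - i) ∧ 2 * (i : ℝ) * (Lr d - i) ≤ 2 * Lr d ^ 2 := by
    intro w i h
    have h1 : (i : ℝ) ≤ Lr d := by
      rw [← hpL]; exact_mod_cast h.2.le
    have h2 : (0:ℝ) ≤ i := Nat.cast_nonneg _
    refine ⟨by positivity, by rw [div_le_one (by linarith)]; exact h1,
      mul_nonneg (by linarith) (by linarith), by nlinarith⟩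
  have key := (good_cond (mk' d m)).mixing_le (oB (mk' d m))
    (fun x => fn (mk' d m) (Nb d m) (fun w => fB d m w.length) (2 * Lr d ^ 2) (-1) x.1)
    (200 * m * Lr d ^ 2) ?_ ?_ ?_ (1600 * m * (8 ^ (d + 4)) ^ 2) ?_ ?_
  · refine key.trans (le_of_eq ?_)
    ring
  · rintro ⟨x, hv⟩
    match x with
    | .B w => exact fB_nn _ _ _
    | .T w i =>
      obtain ⟨h1, h2, h3, h4⟩ := hpath w i hv
      have h5 := Nb_nn (d := d) (m := m) w
      have h6 := pv_nn (d := d) (m := m) w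
      simp only [fn, hpL, mul_div_assoc]
      nlinarith [mul_nonneg h5 (sub_nonneg.2 h2), mul_nonneg h6 h1]
  · rintro ⟨x, hv⟩
    match x with
    | .B w =>
      have h1 := fB_le d m w.length hm hv
      have := Sr_nn d m
      simp only [fn]
      linarith
    | .T w i =>
      obtain ⟨h1, h2, h3, h4⟩ := hpath w i hv
      have h5 := Nb_le' (d := d) hm (w := w) hv.1
      have h6 := pv_le (d := d) hm (w := w) hv.1
      simp only [fn, hpL, mul_div_assoc]
      nlinarith [mul_le_mul_of_nonneg_right h5 (sub_nonneg.2 h2), mul_le_mul_of_nonneg_right h6 h1]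
  · intro x hx
    have := drift_of (ck_cond (mk' d m)) (fun w => (cw_vals w).1) (Nb d m) (fun w => fB d m w.length)
      (2 * Lr d ^ 2) (-1) (fun w => w ≠ []) (by rw [hpL]; nlinarith)
      (fun w hw => by
        rw [hpL]
        exact biased_T (d := d) (m := m) hm w hw)
      (fun w hw hne => biased_B (d := d) (m := m) w hw hne) x (by
        intro w hw hn
        subst hn
        exact hx (Subtype.ext hw))
    linarith
  · apply le_of_eq
    unfold Lr
    push_cast
    ring
  · have : 0 < 8 ^ (d + 4) := by positivity
    have : 0 < 1600 * m * (8 ^ (d + 4)) ^ 2 := by positivity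
    omega

end Par

end Biased
section UnitWalk

namespace Par

/-- The growth rate. -/
noncomputable def rho : ℝ := 201 / 200

/-- Unclipped node values. -/
noncomputable def gU (d m : ℕ) (w : Wd) : ℝ := w.length / d + rho ^ Xw w / rho ^ m

/-- Node values. -/
noncomputable def Nu (d m : ℕ) (w : Wd) : ℝ := min 1 (gU d m w) + 1 / (2 * d)

variable {d m : ℕ}

lemma rho_one : 1 ≤ rho := by unfold rho; norm_num

lemma rho_pos : 0 < rho := by unfold rho; norm_num

lemma gU_nn (w : Wd) : 0 ≤ gU d m w := by
  have := rho_pos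
  unfold gU; positivity

lemma gU_sp (hd : 1 ≤ d) {w : Wd} (h : (mk' d m).sp w) : 1 ≤ gU d m w := by
  have hr := rho_pos
  have hd' : (0:ℝ) < d := by exact_mod_cast hd
  unfold gU
  rcases h with h | h
  · have : 1 ≤ rho ^ Xw w / rho ^ m := by
      rw [one_le_div (by positivity)]
      exact pow_le_pow_right₀ rho_one h
    have : (0:ℝ) ≤ w.length / d := by positivity
    linarith
  · have h' : w.length = d := h
    rw [h', div_self hd'.ne']
    have : 0 ≤ rho ^ Xw w / rho ^ m := by positivity
    linarith

lemma gU_child (w : Wd) (hd : 1 ≤ d) :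
    ∑ e : Fin 8, (gU d m (e :: w) - gU d m w) ≤
      8 / d + rho ^ Xw w / rho ^ m * (4 * rho ^ 7 + 4 / rho ^ 10 - 8) + 4 / rho ^ m := by
  have hr := rho_pos
  have hd' : (0:ℝ) < d := by exact_mod_cast hd
  have hc : ∀ e : Fin 8, gU d m (e :: w) - gU d m w ≤ 1 / d +
      if e < 4 then rho ^ Xw w / rho ^ m * (rho ^ 7 - 1)
        else rho ^ Xw w / rho ^ m * (1 / rho ^ 10 - 1) + 1 / rho ^ m := by
    intro e
    unfold gU
    by_cases he : e < 4
    · have hx : Xw (e :: w) = Xw w + 7 := by simp [Xw, he]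
      rw [if_pos he, hx, pow_add]
      apply le_of_eq
      simp only [List.length_cons]
      push_cast
      ring
    · have hx : Xw (e :: w) = Xw w - 10 := by simp [Xw, he]
      rw [if_neg he, hx]
      have h1 : rho ^ (Xw w - 10) ≤ rho ^ Xw w / rho ^ 10 + 1 := by
        by_cases h : 10 ≤ Xw w
        · have : rho ^ Xw w = rho ^ (Xw w - 10) * rho ^ 10 := by
            rw [← pow_add]; congr 1; omega
          rw [this, mul_div_assoc, div_self (by positivity)]
          linarith
        · have : Xw w - 10 = 0 := by omega
          rw [this, pow_zero]
          have : 0 ≤ rho ^ Xw w / rho ^ 10 := by positivity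
          linarith
      have h2 : rho ^ (Xw w - 10) / rho ^ m ≤ (rho ^ Xw w / rho ^ 10 + 1) / rho ^ m := by
        gcongr
      have h3 : (rho ^ Xw w / rho ^ 10 + 1) / rho ^ m =
          rho ^ Xw w / rho ^ m * (1 / rho ^ 10) + 1 / rho ^ m := by
        field_simp
      rw [h3] at h2
      have h4 : ((e :: w).length : ℝ) / d = w.length / d + 1 / d := by
        simp only [List.length_cons]; push_cast; ring
      rw [h4]
      linarith
  refine (Finset.sum_le_sum fun e _ => hc e).trans ?_
  apply le_of_eq
  rw [Fin.sum_univ_eight]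
  norm_num [Fin.lt_def]
  ring

lemma rho_num : rho ^ 10 - 1 + (4 * rho ^ 7 + 4 / rho ^ 10 - 8) ≤ 0 := by
  unfold rho; norm_num

lemma gU_parent (e : Fin 8) (u : Wd) :
    gU d m u - gU d m (e :: u) ≤ rho ^ Xw (e :: u) / rho ^ m * (rho ^ 10 - 1) := by
  have hr := rho_pos
  have h1 : Xw u ≤ Xw (e :: u) + 10 := by
    simp only [Xw]; split_ifs <;> omega
  have h2 : rho ^ Xw u ≤ rho ^ Xw (e :: u) * rho ^ 10 := by
    rw [← pow_add]; exact pow_le_pow_right₀ rho_one h1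
  have h3 : rho ^ Xw u / rho ^ m ≤ rho ^ Xw (e :: u) * rho ^ 10 / rho ^ m := by gcongr
  unfold gU
  have h4 : (u.length : ℝ) / d ≤ ((e :: u).length : ℝ) / d := by
    gcongr; simp
  have h5 : rho ^ Xw (e :: u) * rho ^ 10 / rho ^ m = rho ^ Xw (e :: u) / rho ^ m * rho ^ 10 := by
    ring
  linarith

lemma Nu_le (w : Wd) : Nu d m w ≤ 1 + 1 / (2 * d) := by
  unfold Nu; linarith [min_le_left 1 (gU d m w)]

lemma Nu_ge (w : Wd) : 1 / (2 * d) ≤ Nu d m w := by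
  unfold Nu; linarith [le_min zero_le_one (gU_nn (d := d) (m := m) w)]

lemma pvu_le (w : Wd) : pv (Nu d m) 0 w ≤ 1 + 1 / (2 * d) := by
  cases w with
  | nil => simp only [pv, add_zero]; exact Nu_le _
  | cons e u => exact Nu_le _

lemma pvu_ge (w : Wd) : 1 / (2 * d) ≤ pv (Nu d m) 0 w := by
  cases w with
  | nil => simp only [pv, add_zero]; exact Nu_ge _
  | cons e u => exact Nu_ge _

/-- Time scale. -/
noncomputable def ep (d : ℕ) : ℝ := 1 / (d * Lr d ^ 2)

theorem unit_T (hd : 1 ≤ d) (hr : 16 * d ≤ rho ^ m) (w : Wd) (hw : w.length ≤ d) :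
    1 * ((pv (Nu d m) 0 w - Nu d m w) / Lr d - 2 * ep d * Lr d) +
      (if w.length < d then ∑ e : Fin 8, 1 *
        ((Nu d m (e :: w) - Nu d m w) / Lr d - 2 * ep d * Lr d)
        else 0) +
      (if (mk' d m).sp w then (1 + 1 / (2 * d)) - Nu d m w - 2 * ep d else 0) ≤ 0 := by
  have hL := Lr_ge d
  have hL0 : 0 < Lr d := by linarith
  have hd' : (0:ℝ) < d := by exact_mod_cast hd
  have hep : 0 < ep d := by unfold ep; positivity
  have heL : 0 ≤ ep d * Lr d := by positivity
  by_cases hg : 1 ≤ gU d m w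
  · have hN : Nu d m w = 1 + 1 / (2 * d) := by unfold Nu; rw [min_eq_left hg]
    have h1 : (pv (Nu d m) 0 w - Nu d m w) / Lr d ≤ 0 :=
      div_nonpos_of_nonpos_of_nonneg (by rw [hN]; linarith [pvu_le (d := d) (m := m) w]) hL0.le
    have h2 : (if w.length < d then ∑ e : Fin 8, 1 *
        ((Nu d m (e :: w) - Nu d m w) / Lr d - 2 * ep d * Lr d) else 0) ≤ 0 := by
      split_ifs
      · refine Finset.sum_nonpos fun e _ => ?_
        have : (Nu d m (e :: w) - Nu d m w) / Lr d ≤ 0 :=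
          div_nonpos_of_nonpos_of_nonneg (by rw [hN]; linarith [Nu_le (d := d) (m := m) (e :: w)]) hL0.le
        linarith
      · exact le_rfl
    have h3 : (if (mk' d m).sp w then (1 + 1 / (2 * d)) - Nu d m w - 2 * ep d else 0) ≤ 0 := by
      split_ifs
      · linarith
      · exact le_rfl
    linarith
  · have hs : ¬ (mk' d m).sp w := fun h => hg (gU_sp hd h)
    have hlt : w.length < d := by
      rcases hw.lt_or_eq with h | h
      · exact h
      · exact absurd (Or.inr h) hs
    rw [if_neg hs, if_pos hlt]
    push Not at hg
    have hN : Nu d m w = gU d m w + 1 / (2 * d) := by unfold Nu; rw [min_eq_right hg.le]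
    set t := rho ^ Xw w / rho ^ m with ht
    have ht0 : 0 ≤ t := by have := rho_pos; positivity
    have hrn := rho_num
    have hpar : pv (Nu d m) 0 w - Nu d m w ≤ t * (rho ^ 10 - 1) := by
      match w with
      | [] =>
        simp only [pv, add_zero, sub_self]
        exact mul_nonneg ht0 (sub_nonneg.2 (one_le_pow₀ rho_one))
      | e :: u =>
        have h1 := gU_parent (d := d) (m := m) e u
        rw [← ht] at h1
        simp only [pv]
        rw [hN]
        have : Nu d m u ≤ gU d m u + 1 / (2 * d) := by
          unfold Nu; linarith [min_le_right 1 (gU d m u)]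
        linarith
    have hch : ∑ e : Fin 8, (Nu d m (e :: w) - Nu d m w) ≤
        8 / d + t * (4 * rho ^ 7 + 4 / rho ^ 10 - 8) + 4 / rho ^ m := by
      refine le_trans (Finset.sum_le_sum fun e _ => ?_) (gU_child (d := d) (m := m) w hd)
      rw [hN]
      have : Nu d m (e :: w) ≤ gU d m (e :: w) + 1 / (2 * d) := by
        unfold Nu; linarith [min_le_right 1 (gU d m (e :: w))]
      linarith
    have hrm : 4 / rho ^ m ≤ 4 / d := by
      apply div_le_div_of_nonneg_left (by norm_num) hd'
      linarith
    have htot : (pv (Nu d m) 0 w - Nu d m w) + ∑ e : Fin 8, (Nu d m (e :: w) - Nu d m w) ≤ 12 / d := by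
      have : t * (rho ^ 10 - 1 + (4 * rho ^ 7 + 4 / rho ^ 10 - 8)) ≤ 0 :=
        mul_nonpos_of_nonneg_of_nonpos ht0 hrn
      have : 12 / (d:ℝ) = 8 / d + 4 / d := by ring
      linarith
    have e1 : 2 * ep d * Lr d = (2 / d) / Lr d := by
      unfold ep; field_simp
    rw [e1]
    simp only [one_mul, ← sub_div]
    rw [← Finset.sum_div, ← add_div, add_zero]
    apply div_nonpos_of_nonpos_of_nonneg _ hL0.le
    rw [Finset.sum_sub_distrib]
    simp only [Finset.sum_const, Finset.card_univ, Fintype.card_fin, nsmul_eq_mul]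
    have : (12:ℝ) / d = 6 * (2 / d) := by ring
    have h2 : (0:ℝ) < 2 / d := by positivity
    push_cast
    linarith

theorem unit_B (hd : 1 ≤ d) (w : Wd) :
    pb (fun _ => 1 + 1 / (2 * (d:ℝ))) (ep d) w +
      (if w.length < 2 * d + 6 then ∑ _e : Fin 8,
        ((1 + 1 / (2 * (d:ℝ))) - (1 + 1 / (2 * (d:ℝ))) - 2 * ep d) else 0) +
      (if w.length ≤ d ∧ (mk' d m).sp w
        then Nu d m w - (1 + 1 / (2 * (d:ℝ))) - 2 * ep d else 0) ≤ 0 := by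
  have hL := Lr_ge d
  have hd' : (0:ℝ) < d := by exact_mod_cast hd
  have hep : 0 < ep d := by unfold ep; positivity
  have h1 : pb (fun _ => 1 + 1 / (2 * (d:ℝ))) (ep d) w ≤ 0 := by
    cases w with
    | nil => exact le_rfl
    | cons e u => simp only [pb]; linarith
  have h2 : (if w.length < 2 * d + 6 then ∑ _e : Fin 8,
        ((1 + 1 / (2 * (d:ℝ))) - (1 + 1 / (2 * (d:ℝ))) - 2 * ep d) else 0) ≤ 0 := by
    split_ifs
    · exact Finset.sum_nonpos fun e _ => by linarith
    · exact le_rfl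
  have h3 : (if w.length ≤ d ∧ (mk' d m).sp w
        then Nu d m w - (1 + 1 / (2 * (d:ℝ))) - 2 * ep d else 0) ≤ 0 := by
    split_ifs
    · linarith [Nu_le (d := d) (m := m) w]
    · exact le_rfl
  linarith

lemma wle_lower (k : ℕ) : 8 ^ k ≤ Nat.card (Wle k) := by
  have h : Nat.card (Fin k → Fin 8) ≤ Nat.card (Wle k) :=
    Nat.card_le_card_of_injective (fun f => (⟨List.ofFn f, by simp⟩ : Wle k))
      (fun f g h => List.ofFn_injective (Subtype.ext_iff.1 h))
  simpa using h

lemma wle_upper (k : ℕ) : Nat.card (Wle k) + 1 ≤ 2 * 8 ^ k := by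
  induction k with
  | zero =>
    have : Nat.card (Wle 0) ≤ 1 := by
      rw [Finite.card_le_one_iff_subsingleton]
      refine ⟨fun a b => Subtype.ext ?_⟩
      have ha := List.length_eq_zero_iff.1 (Nat.le_zero.1 a.2)
      have hb := List.length_eq_zero_iff.1 (Nat.le_zero.1 b.2)
      rw [ha, hb]
    omega
  | succ k ih =>
    have h : Nat.card (Wle (k + 1)) ≤ Nat.card (Option (Fin 8 × Wle k)) := by
      refine Nat.card_le_card_of_surjective (fun o : Option (Fin 8 × Wle k) => (match o with
        | none => ⟨[], by simp⟩
        | some (e, w) => ⟨e :: w.1, by have := w.2; simp; omega⟩ : Wle (k + 1))) ?_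
      rintro ⟨w, hw⟩
      match w with
      | [] => exact ⟨none, rfl⟩
      | e :: u => exact ⟨some (e, ⟨u, by simp at hw; omega⟩), rfl⟩
    rw [Finite.card_option, Nat.card_prod] at h
    rw [Nat.card_eq_fintype_card (α := Fin 8), Fintype.card_fin] at h
    rw [pow_succ]
    omega

/-- Being in the big tree. -/
def isB (p : Par) (x : p.Vt) : Prop := ∃ w, x.1 = .B w

lemma card_B (p : Par) : 8 ^ p.D ≤ (Finset.univ.filter (isB p)).card := by
  refine (wle_lower p.D).trans ?_
  have : Nat.card (Wle p.D) ≤ Nat.card {x // x ∈ Finset.univ.filter (isB p)} :=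
    Nat.card_le_card_of_injective (fun w => ⟨⟨.B w.1, w.2⟩,
      Finset.mem_filter.2 ⟨Finset.mem_univ _, w.1, rfl⟩⟩)
      (fun a b h => by
        have h := Subtype.ext_iff.1 (Subtype.ext_iff.1 h)
        exact Subtype.ext (Raw.B.inj h))
  rwa [Nat.card_eq_finsetCard] at this

lemma card_T (p : Par) : (Finset.univ.filter (fun x => ¬ isB p x)).card ≤ 2 * 8 ^ p.d * p.L := by
  have : Nat.card {x // x ∈ Finset.univ.filter (fun x => ¬ isB p x)} ≤ Nat.card (Wle p.d × Fin p.L) := by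
    refine Nat.card_le_card_of_surjective
      (fun y => (⟨⟨.T y.1.1 y.2.1, y.1.2, y.2.2⟩,
        Finset.mem_filter.2 ⟨Finset.mem_univ _, by rintro ⟨w, hw⟩; cases hw⟩⟩ :
        {x // x ∈ Finset.univ.filter (fun x => ¬ isB p x)})) ?_
    rintro ⟨⟨x, hv⟩, hx⟩
    match x with
    | .T w i => exact ⟨(⟨w, hv.1⟩, ⟨i, hv.2⟩), rfl⟩
    | .B w => exact absurd ⟨w, rfl⟩ (Finset.mem_filter.1 hx).2
  rw [Nat.card_prod] at this
  have h1 := wle_upper p.d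
  have h2 : Nat.card (Wle p.d) * Nat.card (Fin p.L) ≤ 2 * 8 ^ p.d * p.L := by
    rw [Nat.card_eq_fintype_card (α := Fin p.L), Fintype.card_fin]
    exact Nat.mul_le_mul_right _ (by omega)
  have h3 := this.trans h2
  rwa [Nat.card_eq_finsetCard] at h3

lemma card_bounds (d m : ℕ) : 8 ^ (2 * d + 6) ≤ Fintype.card (mk' d m).Vt ∧
    Fintype.card (mk' d m).Vt ≤ 8 ^ (2 * d + 7) := by
  constructor
  · exact (card_B (mk' d m)).trans (Finset.card_le_univ _)
  · have e : Nat.card (mk' d m).Vt = Nat.card (Wle d) * 8 ^ (d + 4) + Nat.card (Wle (2 * d + 6)) := by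
      rw [Nat.card_congr (mk' d m).vtEquiv, Nat.card_sum, Nat.card_prod,
        Nat.card_eq_fintype_card (α := Fin _), Fintype.card_fin]
      rfl
    rw [← Nat.card_eq_fintype_card, e]
    have h1 := wle_upper d
    have h2 := wle_upper (2 * d + 6)
    calc _ ≤ (2 * 8 ^ d) * 8 ^ (d + 4) + 2 * 8 ^ (2 * d + 6) :=
          add_le_add (Nat.mul_le_mul_right _ (by omega)) (by omega)
      _ ≤ 8 ^ (2 * d + 7) := by
          have : (2 * 8 ^ d) * 8 ^ (d + 4) = 2 * 8 ^ 4 * 8 ^ (2 * d) := by ring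
          rw [this, pow_add, pow_add]
          have : 0 < 8 ^ (2 * d) := by positivity
          omega

lemma mass_B (d m : ℕ) : 3 / 4 ≤ ∑ x ∈ Finset.univ.filter (isB (mk' d m)),
    statDist (mk' d m).Gr (fun _ _ => 1) x := by
  have hg := good_unit (mk' d m)
  have hcs : ∀ x : (mk' d m).Vt, 1 ≤ cs (mk' d m).Gr (fun _ _ => 1) x ∧
      cs (mk' d m).Gr (fun _ _ => 1) x ≤ 10 := by
    intro x
    have hd := (mk' d m).degree_le x
    have hpos := hg.cs_pos x
    have e : cs (mk' d m).Gr (fun _ _ => (1:ℝ)) x =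
        (({u | (mk' d m).Gr.Adj x u} : Set (mk' d m).Vt).ncard : ℝ) := by
      unfold cs
      rw [Finset.sum_const, nsmul_eq_mul, mul_one]
      have e : ({u | (mk' d m).Gr.Adj x u} : Set (mk' d m).Vt) =
        ((Finset.univ.filter ((mk' d m).Gr.Adj x ·) : Finset (mk' d m).Vt) : Set (mk' d m).Vt) := by
        ext; simp
      rw [e, Set.ncard_coe_finset]
    rw [e] at hpos ⊢
    exact ⟨by exact_mod_cast hpos, by exact_mod_cast hd⟩
  set A := ∑ x ∈ Finset.univ.filter (isB (mk' d m)), cs (mk' d m).Gr (fun _ _ => (1:ℝ)) x with hA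
  set Z := ∑ x ∈ Finset.univ.filter (fun x => ¬ isB (mk' d m) x), cs (mk' d m).Gr (fun _ _ => (1:ℝ)) x with hZ
  have htot : ∑ x, cs (mk' d m).Gr (fun _ _ => (1:ℝ)) x = A + Z :=
    (Finset.sum_filter_add_sum_filter_not _ _ _).symm
  have hA1 : (8:ℝ) ^ (2 * d + 6) ≤ A := by
    have h1 : ∑ x ∈ Finset.univ.filter (isB (mk' d m)), (1:ℝ) ≤ A :=
      Finset.sum_le_sum fun x _ => (hcs x).1
    have h2 := card_B (mk' d m)
    rw [Finset.sum_const, nsmul_eq_mul, mul_one] at h1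
    refine le_trans ?_ h1
    exact_mod_cast h2
  have hZ1 : Z ≤ 20 * 8 ^ 4 * 8 ^ (2 * d) := by
    have h1 : Z ≤ ∑ x ∈ Finset.univ.filter (fun x => ¬ isB (mk' d m) x), (10:ℝ) :=
      Finset.sum_le_sum fun x _ => (hcs x).2
    have h2 := card_T (mk' d m)
    rw [Finset.sum_const, nsmul_eq_mul] at h1
    have h3 : ((Finset.univ.filter (fun x => ¬ isB (mk' d m) x)).card : ℝ) ≤ 2 * 8 ^ d * 8 ^ (d + 4) := by
      exact_mod_cast h2
    have h4 : (2 * 8 ^ d * 8 ^ (d + 4) : ℝ) = 2 * 8 ^ 4 * 8 ^ (2 * d) := by ring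
    linarith
  have hq : (0:ℝ) < 8 ^ (2 * d) := by positivity
  have hA2 : (8:ℝ) ^ (2 * d + 6) = 8 ^ 6 * 8 ^ (2 * d) := by ring
  have hApos : 0 < A := by
    refine lt_of_lt_of_le (by positivity) hA1
  have hZ0 : 0 ≤ Z := Finset.sum_nonneg fun x _ => by linarith [(hcs x).1]
  have : ∑ x ∈ Finset.univ.filter (isB (mk' d m)), statDist (mk' d m).Gr (fun _ _ => 1) x = A / (A + Z) := by
    rw [← htot, hA, Finset.sum_div]; rfl
  rw [this, le_div_iff₀ (by linarith)]
  rw [hA2] at hA1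
  norm_num at hA1 hZ1
  linarith

theorem unit_bound [DecidableEq (mk' d m).Vt] (hd : 16 ≤ d) (hr : 16 * d ≤ rho ^ m) :
    16 * d * (8 ^ (d + 3)) ^ 2 ≤ mixingTime (mk' d m).Gr (fun _ _ : (mk' d m).Vt => (1:ℝ)) := by
  have hL := Lr_ge d
  have hL0 : 0 < Lr d := by linarith
  have hd1 : 1 ≤ d := by omega
  have hd' : (0:ℝ) < d := by exact_mod_cast hd1
  have hd16 : (16:ℝ) ≤ d := by exact_mod_cast hd
  have hep : 0 < ep d := by unfold ep; positivity
  have hpL : ((mk' d m).L : ℝ) = Lr d := mk_L d m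
  have hv0 : (mk' d m).Valid (.T [] 0) := ⟨by simp, by have := (mk' d m).hL; omega⟩
  refine unit_lower (good_unit _) ⟨.T [] 0, hv0⟩
    (unit_finite (good_unit _) (oB _) (fun x => rk _ x.1) (rank_dec _) _)
    (fun x => fn (mk' d m) (Nu d m) (fun _ => 1 + 1 / (2 * d)) 0 (ep d) x.1)
    (isB (mk' d m)) (ep d) _ hep.le ?_ ?_ ?_ (mass_B d m) ?_
  · rintro ⟨x, hv⟩
    match x with
    | .B w => simp only [fn]; positivity
    | .T w i =>
      have h1 : (i : ℝ) ≤ Lr d := by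
        rw [← hpL]; exact_mod_cast hv.2.le
      have h2 : (0:ℝ) ≤ i := Nat.cast_nonneg _
      have h3 : 0 ≤ (i:ℝ) / Lr d := by positivity
      have h4 : (i:ℝ) / Lr d ≤ 1 := by rw [div_le_one hL0]; exact h1
      have h5 := Nu_ge (d := d) (m := m) w
      have h6 := pvu_ge (d := d) (m := m) w
      have h7 : 2 * ep d * i * (Lr d - i) ≤ 1 / (2 * d) := by
        have : (1:ℝ) / (2 * d) = ep d * (Lr d ^ 2 / 2) := by unfold ep; field_simp
        rw [this]
        have : 2 * ep d * i * (Lr d - i) = ep d * (2 * i * (Lr d - i)) := by ring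
        rw [this]
        apply mul_le_mul_of_nonneg_left _ hep.le
        nlinarith [sq_nonneg (Lr d - 2 * i)]
      simp only [fn, hpL, mul_div_assoc]
      nlinarith [mul_le_mul_of_nonneg_right h5 (sub_nonneg.2 h4), mul_le_mul_of_nonneg_right h6 h3]
  · rintro ⟨x, hv⟩ ⟨w, hw⟩
    simp only at hw
    subst hw
    simp only [fn]
    have : (0:ℝ) ≤ 1 / (2 * d) := by positivity
    linarith
  · intro x
    exact drift_of (ck_unit (mk' d m)) (fun w => zero_le_one) (Nu d m) (fun _ => 1 + 1 / (2 * d))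
      0 (ep d) (fun _ => True) (by
        rw [hpL, neg_zero]
        apply mul_nonneg (by positivity); linarith)
      (fun w hw => by
        rw [hpL]
        exact unit_T (d := d) (m := m) hd1 hr w hw)
      (fun w _ _ => unit_B (d := d) (m := m) hd1 w) x (fun _ _ => trivial)
  · have h1 : ((16 * d * (8 ^ (d + 3)) ^ 2 : ℕ) : ℝ) * ep d = 1 / 4 := by
      have : Lr d = 8 * 8 ^ (d + 3) := by unfold Lr; ring
      unfold ep
      rw [this]
      push_cast
      field_simp
      norm_num
    rw [h1]
    simp only [fn, Nu, gU, Xw]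
    have h2 : min (1:ℝ) (([] : Wd).length / d + rho ^ 0 / rho ^ m) ≤ 1 / 256 := by
      refine (min_le_right _ _).trans ?_
      simp
      rw [inv_le_comm₀ (by have := rho_pos; positivity) (by norm_num)]
      linarith
    have h3 : (1:ℝ) / (2 * d) ≤ 1 / 32 := by
      apply one_div_le_one_div_of_le <;> linarith
    simp only [Nat.cast_zero, mul_zero, zero_div, zero_mul]
    linarith

end Par

end UnitWalk
section Final

namespace Par

lemma rho_big (j : ℕ) : (16 * (2 ^ j : ℕ) : ℝ) ≤ rho ^ (200 * (j + 4)) := by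
  have h1 : (2:ℝ) ≤ rho ^ 200 := by
    have := one_add_mul_le_pow (a := (1:ℝ) / 200) (by norm_num) 200
    have e : rho = 1 + 1 / 200 := by unfold rho; norm_num
    rw [e]
    norm_num at this ⊢
  calc (16 * (2 ^ j : ℕ) : ℝ) = 2 ^ (j + 4) := by push_cast; ring
    _ ≤ (rho ^ 200) ^ (j + 4) := by gcongr
    _ = _ := by rw [← pow_mul]

/-- The family. -/
def fam (j : ℕ) : Par := mk' (2 ^ j) (200 * (j + 4))

/-- The sizes. -/
noncomputable def sz (j : ℕ) : ℕ := Fintype.card (fam j).Vt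

lemma final_num (j : ℕ) (hj : 4 ≤ j) (n : ℕ) (A U : ℕ)
    (h1 : 8 ^ (2 * 2 ^ j + 6) ≤ n) (h2 : n ≤ 8 ^ (2 * 2 ^ j + 7))
    (hA : A ≤ 3200 * (200 * (j + 4)) * (8 ^ (2 ^ j + 4)) ^ 2)
    (hU : 16 * 2 ^ j * (8 ^ (2 ^ j + 3)) ^ 2 ≤ U) :
    (1 / 10 ^ 9 : ℝ) * Real.log n / Real.log (Real.log n) * (A : ℝ) ≤ U := by
  set d : ℝ := 2 ^ j with hd
  have hd16 : (16:ℝ) ≤ d := by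
    rw [hd]
    calc (16:ℝ) = 2 ^ 4 := by norm_num
      _ ≤ 2 ^ j := pow_le_pow_right₀ (by norm_num) hj
  have hn0 : 0 < n := lt_of_lt_of_le (by positivity) h1
  have hn : (0:ℝ) < n := by exact_mod_cast hn0
  have l8 : Real.log 8 = 3 * Real.log 2 := by
    rw [show (8:ℝ) = 2 ^ 3 by norm_num, Real.log_pow]; norm_num
  have l2a := Real.log_two_gt_d9
  have l2b := Real.log_two_lt_d9
  have hlo : d ≤ Real.log n := by
    have : Real.log ((8:ℝ) ^ (2 * 2 ^ j + 6)) ≤ Real.log n :=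
      Real.log_le_log (by positivity) (by exact_mod_cast h1)
    rw [Real.log_pow, l8] at this
    push_cast at this
    rw [← hd] at this
    nlinarith
  have hhi : Real.log n ≤ 9 * d := by
    have : Real.log n ≤ Real.log ((8:ℝ) ^ (2 * 2 ^ j + 7)) :=
      Real.log_le_log hn (by exact_mod_cast h2)
    rw [Real.log_pow, l8] at this
    push_cast at this
    rw [← hd] at this
    nlinarith
  have hj' : (4:ℝ) ≤ j := by exact_mod_cast hj
  have hll : (j:ℝ) / 2 ≤ Real.log (Real.log n) := by
    have : Real.log d ≤ Real.log (Real.log n) := Real.log_le_log (by linarith) hlo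
    rw [hd, Real.log_pow] at this
    nlinarith
  have hA' : (A:ℝ) ≤ 3200 * (200 * (j + 4)) * (8 ^ (2 ^ j + 4)) ^ 2 := by exact_mod_cast hA
  have hU' : 16 * d * ((8:ℝ) ^ (2 ^ j + 3)) ^ 2 ≤ U := by rw [hd]; exact_mod_cast hU
  set q : ℝ := (8 ^ (2 ^ j + 3)) ^ 2 with hq
  have hq0 : 0 < q := by positivity
  have e8 : ((8:ℝ) ^ (2 ^ j + 4)) ^ 2 = 64 * q := by rw [hq]; ring
  rw [e8] at hA'
  refine le_trans ?_ hU'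
  have hA2 : (A:ℝ) ≤ 81920000 * j * q := by
    have : (j + 4 : ℝ) ≤ 2 * j := by linarith
    nlinarith [mul_le_mul_of_nonneg_right this hq0.le]
  have hA0 : (0:ℝ) ≤ A := Nat.cast_nonneg _
  have hdiv : (1 / 10 ^ 9 : ℝ) * Real.log n / Real.log (Real.log n) ≤
      (1 / 10 ^ 9 * (9 * d)) / (j / 2) := by
    apply div_le_div₀ (by positivity) (by gcongr) (by linarith) hll
  calc _ ≤ (1 / 10 ^ 9 * (9 * d)) / (j / 2) * (81920000 * j * q) := by gcongr
    _ = (1 / 10 ^ 9 * 18 * 81920000) * d * q := by field_simp; norm_num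
    _ ≤ 16 * d * q := by
      have : 0 ≤ d * q := by positivity
      nlinarith

end Par

end Final

/-- **Sensitivity of mixing times** (Ding–Peres).
There are an absolute constant `c > 0`, an infinite set `N ⊆ ℕ` and, for each `n ∈ N`,
a connected graph `G` on `n` vertices with maximum degree at most `10` together with
conductances `cond` taking values in `{1, 2}` on the edges, such that the mixing time
of the lazy simple random walk (unit conductances) is at least
`c · log n / log log n` times the mixing time of the lazy walk on the network `(G, cond)`.
In particular this family of graphs is not robust. -/
theorem mixing_time_sensitive :
    ∃ c : ℝ, 0 < c ∧ ∃ N : Set ℕ, N.Infinite ∧ ∀ n ∈ N,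
      ∃ G : SimpleGraph (Fin n), G.Connected ∧ (∀ v, {u | G.Adj v u}.ncard ≤ 10) ∧
      ∃ cond : Fin n → Fin n → ℝ,
        (∀ u v, cond u v = cond v u) ∧
        (∀ u v, G.Adj u v → cond u v = 1 ∨ cond u v = 2) ∧
        c * Real.log n / Real.log (Real.log n) * (mixingTime G cond : ℝ) ≤
          (mixingTime G (fun _ _ => 1) : ℝ) := by
  refine ⟨1 / 10 ^ 9, by norm_num, Set.image Par.sz {j | 4 ≤ j}, ?_, ?_⟩
  · intro hfin
    obtain ⟨M, hM⟩ := hfin.bddAbove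
    have h1 : Par.sz (M + 4) ≤ M := hM ⟨M + 4, by simp, rfl⟩
    have h2 : 8 ^ (2 * 2 ^ (M + 4) + 6) ≤ Par.sz (M + 4) := (Par.card_bounds _ _).1
    have h3 : M + 4 < 2 ^ (M + 4) := Nat.lt_two_pow_self
    have h4 : 2 * 2 ^ (M + 4) + 6 < 8 ^ (2 * 2 ^ (M + 4) + 6) := Nat.lt_pow_self (by norm_num)
    omega
  · rintro n ⟨j, hj, rfl⟩
    have hj : 4 ≤ j := hj
    have e : Fin (Par.sz j) ≃ (Par.fam j).Vt := (Fintype.equivFin (Par.fam j).Vt).symm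
    have hconn : (Par.fam j).Gr.Connected :=
      rank_connected _ (Par.oB _) (fun x => Par.rk _ x.1) (Par.rank_dec _)
    refine ⟨(Par.fam j).Gr.comap e, ?_, ?_, fun a b => (Par.fam j).cond (e a).1 (e b).1, ?_, ?_, ?_⟩
    · exact (SimpleGraph.Iso.connected_iff (SimpleGraph.Iso.comap e (Par.fam j).Gr)).2 hconn
    · intro v
      have h := (Par.fam j).degree_le (e v)
      have e1 : ({u | ((Par.fam j).Gr.comap e).Adj v u} : Set (Fin (Par.sz j))) =
          Set.preimage e {u | (Par.fam j).Gr.Adj (e v) u} := rfl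
      rw [e1, Set.ncard_preimage_of_injective_subset_range e.injective (by simp [e.surjective.range_eq])]
      exact h
    · intro u v
      exact (Par.fam j).cond_symm _ _
    · intro u v _
      exact (Par.fam j).cond_vals _ _
    · have hA := Par.cond_upper (d := 2 ^ j) (m := 200 * (j + 4)) (by omega)
      have hd16 : 16 ≤ 2 ^ j := by
        calc 16 = 2 ^ 4 := by norm_num
          _ ≤ 2 ^ j := Nat.pow_le_pow_right (by norm_num) hj
      have hU := Par.unit_bound (d := 2 ^ j) (m := 200 * (j + 4)) hd16 (Par.rho_big j)
      have e1 := mixing_equiv e (Par.fam j).Gr (fun a b => (Par.fam j).cond a.1 b.1)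
      have e2 := mixing_equiv e (Par.fam j).Gr (fun _ _ => 1)
      rw [e1, e2]
      have hb := Par.card_bounds (2 ^ j) (200 * (j + 4))
      exact Par.final_num j hj _ _ _ hb.1 hb.2 hA hU
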